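/- Let G be a finite non-solvable group and L a nilpotent maximal subgroup of G. Then a Sylow 2-subgroup of L is also a Sylow 2-subgroup of G. -/

import Mathlib

section NilpotentMaximal

open Subgroup
open scoped commutatorElement

/-- A finite group is `p`-nilpotent if it has a normal `p`-complement: a normal subgroup of order
prime to `p` and of `p`-power index. -/
def IsPNilpotent (p : ℕ) (G : Type*) [Group G] : Prop :=
  ∃ N : Subgroup G, N.Normal ∧ ¬ p ∣ Nat.card N ∧ ∃ k, N.index = p ^ k

section PNilpotent

variable {p : ℕ} [hp : Fact p.Prime] {G H : Type*} [Group G] [Group H] [Finite G]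

theorem Subgroup.not_dvd_card_iff (K : Subgroup G) :
    ¬ p ∣ Nat.card K ↔ ∀ x ∈ K, orderOf x = p → False := by
  constructor
  · rintro h x hx rfl
    exact h (Subgroup.orderOf_dvd_natCard _ hx)
  · intro h hdvd
    obtain ⟨x, hx⟩ := exists_prime_orderOf_dvd_card' p hdvd
    exact h x x.2 (by rw [Subgroup.orderOf_coe, hx])

theorem IsPNilpotent.of_hom [Finite H] (f : G →* H) (hf : ¬ p ∣ Nat.card f.ker)
    (h : IsPNilpotent p H) : IsPNilpotent p G := by
  obtain ⟨N, hN, hNp, k, hk⟩ := h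
  refine ⟨N.comap f, inferInstance, ?_, ?_⟩
  · rw [Subgroup.not_dvd_card_iff] at hf hNp ⊢
    intro x hx hxp
    have h1 : orderOf (f x) ∣ p := hxp ▸ orderOf_map_dvd f x
    rcases (Nat.dvd_prime hp.out).1 h1 with h2 | h2
    · exact hf x (orderOf_eq_one_iff.1 h2) hxp
    · exact hNp _ hx h2
  · rw [Subgroup.index_comap]
    obtain ⟨j, -, hj⟩ := (Nat.dvd_prime_pow hp.out).1
      (hk ▸ Subgroup.relIndex_dvd_index_of_normal N f.range)
    exact ⟨j, hj⟩

theorem IsPNilpotent.of_injective [Finite H] (f : G →* H) (hf : Function.Injective f)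
    (h : IsPNilpotent p H) : IsPNilpotent p G :=
  h.of_hom f (by
    rw [(MonoidHom.ker_eq_bot_iff f).2 hf, Subgroup.card_bot]
    exact hp.out.one_lt.ne' ∘ Nat.dvd_one.1)

theorem IsPNilpotent.of_le {K L : Subgroup G} (hKL : K ≤ L) (h : IsPNilpotent p L) :
    IsPNilpotent p K :=
  h.of_injective (Subgroup.inclusion hKL) (Subgroup.inclusion_injective hKL)

theorem IsPNilpotent.to_subgroup (h : IsPNilpotent p G) (K : Subgroup G) : IsPNilpotent p K :=
  h.of_injective K.subtype K.subtype_injective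

omit [Finite G] in
theorem IsPNilpotent.of_surjective (f : G →* H) (hf : Function.Surjective f)
    (h : IsPNilpotent p G) : IsPNilpotent p H := by
  obtain ⟨N, hN, hNp, k, hk⟩ := h
  refine ⟨N.map f, hN.map f hf, fun h => hNp (h.trans (N.card_map_dvd f)), ?_⟩
  obtain ⟨j, -, hj⟩ := (Nat.dvd_prime_pow hp.out).1 (hk ▸ N.index_map_dvd hf)
  exact ⟨j, hj⟩

theorem IsPGroup.isPNilpotent (h : IsPGroup p G) : IsPNilpotent p G := by
  refine ⟨⊥, inferInstance, ?_, ?_⟩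
  · rw [Subgroup.card_bot]
    exact hp.out.one_lt.ne' ∘ Nat.dvd_one.1
  · rw [Subgroup.index_bot]
    exact IsPGroup.iff_card.1 h

omit [Finite G] in
/-- A normal `p`-complement consists of the elements of order prime to `p`. -/
theorem Subgroup.mem_pComplement_iff {N : Subgroup G} [N.Normal] (hN : ¬ p ∣ Nat.card N) {k : ℕ}
    (hk : N.index = p ^ k) (x : G) : x ∈ N ↔ ¬ p ∣ orderOf x := by
  constructor
  · intro hx h
    exact hN (h.trans (Subgroup.orderOf_dvd_natCard _ hx))
  · intro hx
    rw [← QuotientGroup.eq_one_iff, ← orderOf_eq_one_iff]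
    have h1 : orderOf (x : G ⧸ N) ∣ orderOf x := orderOf_map_dvd (QuotientGroup.mk' N) x
    have h2 : orderOf (x : G ⧸ N) ∣ p ^ k := hk ▸ _root_.orderOf_dvd_natCard (x : G ⧸ N)
    obtain ⟨j, -, hj⟩ := (Nat.dvd_prime_pow hp.out).1 h2
    rcases j with _ | j
    · simpa using hj
    · exact absurd ((Dvd.intro_left _ (by rw [hj, pow_succ])).trans h1) hx

omit [Finite G] in
theorem Subgroup.characteristic_of_pComplement {N : Subgroup G} [N.Normal]
    (hN : ¬ p ∣ Nat.card N) {k : ℕ} (hk : N.index = p ^ k) : N.Characteristic := by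
  rw [Subgroup.characteristic_iff_comap_eq]
  intro φ
  ext x
  rw [Subgroup.mem_comap, mem_pComplement_iff hN hk, mem_pComplement_iff hN hk]
  have : orderOf (φ.toMonoidHom x) = orderOf x := MulEquiv.orderOf_eq φ x
  rw [this]

omit [Finite G] in
/-- The normal `p`-complement of a normal `p`-nilpotent subgroup is normal in the whole group. -/
theorem IsPNilpotent.exists_normal {K : Subgroup G} [hK : K.Normal] (h : IsPNilpotent p K) :
    ∃ N : Subgroup G, N.Normal ∧ N ≤ K ∧ ¬ p ∣ Nat.card N ∧ ∃ k, N.relIndex K = p ^ k := by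
  obtain ⟨N, hN, hNp, k, hk⟩ := h
  have := Subgroup.characteristic_of_pComplement hNp hk
  refine ⟨N.map K.subtype, inferInstance, Subgroup.map_subtype_le N, ?_, k, ?_⟩
  · rwa [Subgroup.card_map_of_injective K.subtype_injective]
  · rw [← hk, Subgroup.relIndex, Subgroup.subgroupOf,
      Subgroup.comap_map_eq_self_of_injective K.subtype_injective]

omit [Finite G] in
theorem IsPNilpotent.of_normal_of_index {K : Subgroup G} [hK : K.Normal] (h : IsPNilpotent p K)
    {j : ℕ} (hj : K.index = p ^ j) : IsPNilpotent p G := by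
  obtain ⟨N, hN, hNK, hNp, k, hk⟩ := h.exists_normal
  exact ⟨N, hN, hNp, k + j, by rw [← Subgroup.relIndex_mul_index hNK, hk, hj, pow_add]⟩

omit [Finite G] in
theorem IsPNilpotent.isPGroup_of_normal {K : Subgroup G} [hK : K.Normal] (h : IsPNilpotent p K)
    (hG : ∀ N : Subgroup G, N.Normal → ¬ p ∣ Nat.card N → N = ⊥) : IsPGroup p K := by
  obtain ⟨N, hN, hNK, hNp, k, hk⟩ := h.exists_normal
  rw [hG N hN hNp, Subgroup.relIndex_bot_left] at hk
  exact IsPGroup.of_card hk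

theorem IsPGroup.disjoint_of_not_dvd {P N : Subgroup G} (hP : IsPGroup p P)
    (hN : ¬ p ∣ Nat.card N) : Disjoint P N := by
  refine Subgroup.disjoint_of_coprime_natCard ?_
  obtain ⟨n, hn⟩ := IsPGroup.iff_card.1 hP
  rw [hn]
  exact ((Nat.Prime.coprime_iff_not_dvd hp.out).2 hN).pow_left n

theorem Subgroup.sup_eq_top_of_pComplement {N : Subgroup G} {k : ℕ} (hk : N.index = p ^ k)
    (P : Sylow p G) : N ⊔ P = ⊤ := by
  rw [← Subgroup.index_eq_one]
  have h1 : (N ⊔ P).index ∣ p ^ k := hk ▸ Subgroup.index_dvd_of_le le_sup_left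
  have h2 : (N ⊔ P).index ∣ P.index := Subgroup.index_dvd_of_le le_sup_right
  exact Nat.eq_one_of_dvd_coprimes
    (((Nat.Prime.coprime_iff_not_dvd hp.out).2 P.not_dvd_index).pow_left k) h1 h2

end PNilpotent

/-- In a nilpotent subgroup, normalizers of proper subgroups grow. -/
theorem Subgroup.lt_normalizer_inf_of_isNilpotent {G : Type*} [Group G] {D P : Subgroup G}
    [hP : Group.IsNilpotent P] (hD : D < P) : D < normalizer (D : Set G) ⊓ P := by
  refine lt_of_le_of_ne (le_inf le_normalizer hD.le) fun h => ?_
  have h1 : D.subgroupOf P < ⊤ := by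
    rw [lt_top_iff_ne_top, Ne, Subgroup.subgroupOf_eq_top]
    exact not_le_of_gt hD
  have h2 := Group.normalizerCondition_of_isNilpotent _ h1
  rw [← Subgroup.subgroupOf_normalizer_eq hD.le] at h2
  obtain ⟨x, hx, hx'⟩ := SetLike.exists_of_lt h2
  apply hx'
  rw [Subgroup.mem_subgroupOf] at hx ⊢
  rw [h]
  exact ⟨hx, x.2⟩

theorem Sylow.mem_smul_iff {p : ℕ} {G : Type*} [Group G] (P : Sylow p G) (g x : G) :
    x ∈ g • P ↔ g⁻¹ * x * g ∈ P := by
  rw [← SetLike.mem_coe, Sylow.coe_smul, Set.mem_smul_set_iff_inv_smul_mem]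
  simp [← map_inv]

section Frobenius

variable {p : ℕ} [hp : Fact p.Prime] {G : Type*} [Group G] [Finite G]

/-- A Sylow `p`-subgroup of a `p`-nilpotent group is conjugated to any other one by an element
commuting with every normal `p`-subgroup. -/
theorem IsPNilpotent.exists_smul_eq (h : IsPNilpotent p G) (D : Subgroup G) [D.Normal]
    (hD : IsPGroup p D) (S T : Sylow p G) : ∃ m ∈ centralizer (D : Set G), m • S = T := by
  obtain ⟨M, hM, hMp, k, hk⟩ := h
  obtain ⟨n, hn⟩ := MulAction.exists_smul_eq G S T
  have hn' : n ∈ M ⊔ (S : Subgroup G) := by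
    rw [Subgroup.sup_eq_top_of_pComplement hk]
    trivial
  obtain ⟨m, hm, s, hs, rfl⟩ := Subgroup.mem_sup_of_normal_left.1 hn'
  refine ⟨m, mem_centralizer_iff.2 fun d hd => ?_, ?_⟩
  · exact commute_of_normal_of_disjoint D M inferInstance hM (hD.disjoint_of_not_dvd hMp) d m hd hm
  · rw [← hn, mul_smul, Sylow.smul_eq_iff_mem_normalizer.2 (le_normalizer hs)]

/-- If all normalizers of nontrivial `p`-subgroups are `p`-nilpotent, then two Sylow `p`-subgroups
are conjugate by an element centralizing their intersection. -/
theorem Sylow.exists_mem_centralizer_inf_smul_eq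
    (h : ∀ H : Subgroup G, IsPGroup p H → H ≠ ⊥ → IsPNilpotent p (normalizer (H : Set G)))
    (P Q : Sylow p G) :
    ∃ c ∈ centralizer (((P : Subgroup G) ⊓ Q : Subgroup G) : Set G), c • P = Q := by
  induction hn : Nat.card G - Nat.card ((P : Subgroup G) ⊓ Q : Subgroup G)
    using Nat.strong_induction_on generalizing P Q with
  | _ n ih =>
  set D : Subgroup G := (P : Subgroup G) ⊓ Q with hD
  have hDP : D ≤ P := inf_le_left
  have hDQ : D ≤ Q := inf_le_right
  have key : ∀ (P Q : Sylow p G), D < (P : Subgroup G) ⊓ Q →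
      ∃ c ∈ centralizer (D : Set G), c • P = Q := by
    intro P' Q' hlt
    have h1 : Nat.card D < Nat.card ((P' : Subgroup G) ⊓ Q' : Subgroup G) :=
      Set.Finite.card_lt_card (Set.toFinite _) hlt
    have h2 := Subgroup.card_le_card_group ((P' : Subgroup G) ⊓ Q' : Subgroup G)
    obtain ⟨c, hc, hc'⟩ := ih _ (by omega) P' Q' rfl
    exact ⟨c, centralizer_le hlt.le hc, hc'⟩
  by_cases hPQ : P = Q
  · exact ⟨1, one_mem _, by rw [one_smul, hPQ]⟩
  rcases eq_or_ne D ⊥ with hbot | hbot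
  · obtain ⟨c, hc⟩ := MulAction.exists_smul_eq G P Q
    refine ⟨c, ?_, hc⟩
    rw [hbot, mem_centralizer_iff]
    rintro x hx
    rw [Subgroup.mem_bot.1 hx, one_mul, mul_one]
  have hltP : D < P := by
    refine lt_of_le_of_ne hDP fun h => hPQ ?_
    exact Sylow.ext (P.is_maximal' Q.2 (h ▸ hDQ)).symm
  have hltQ : D < Q := by
    refine lt_of_le_of_ne hDQ fun h => hPQ ?_
    exact Sylow.ext (Q.is_maximal' P.2 (h ▸ hDP))
  have : Group.IsNilpotent P := P.2.isNilpotent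
  have : Group.IsNilpotent Q := Q.2.isNilpotent
  have hP1 := Subgroup.lt_normalizer_inf_of_isNilpotent hltP
  have hQ1 := Subgroup.lt_normalizer_inf_of_isNilpotent hltQ
  have hDp : IsPGroup p D := P.2.to_le hDP
  have hN := h D hDp hbot
  set N := normalizer (D : Set G) with hNdef
  obtain ⟨S, hS⟩ := (P.2.comap_subtype (K := N)).exists_le_sylow
  obtain ⟨T, hT⟩ := (Q.2.comap_subtype (K := N)).exists_le_sylow
  obtain ⟨m, hm, hmST⟩ := hN.exists_smul_eq (D.subgroupOf N) hDp.comap_subtype S T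
  obtain ⟨R, hR⟩ := (S.2.map N.subtype).exists_le_sylow
  obtain ⟨c₁, hc₁, hc₁'⟩ := key P R (lt_of_lt_of_le hP1 (le_inf inf_le_right fun x hx =>
    hR ⟨⟨x, hx.1⟩, hS hx.2, rfl⟩))
  obtain ⟨c₂, hc₂, hc₂'⟩ := key ((m : G) • R) Q (lt_of_lt_of_le hQ1 (le_inf (fun x hx => by
    have h1 : (⟨x, hx.1⟩ : N) ∈ m • S := hmST ▸ hT hx.2
    rw [Sylow.mem_smul_iff] at h1
    exact (Sylow.mem_smul_iff _ _ _).2 (hR ⟨_, h1, rfl⟩)) inf_le_right))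
  refine ⟨c₂ * m * c₁, mul_mem (mul_mem hc₂ ?_) hc₁, ?_⟩
  · rw [mem_centralizer_iff] at hm ⊢
    intro d hd
    exact congrArg Subtype.val (hm ⟨d, le_normalizer hd⟩ hd)
  · rw [mul_smul, mul_smul, hc₁', hc₂']

/-- If all normalizers of nontrivial `p`-subgroups are `p`-nilpotent, then a Sylow `p`-subgroup
controls its own fusion. -/
theorem Sylow.exists_mem_conj_eq
    (h : ∀ H : Subgroup G, IsPGroup p H → H ≠ ⊥ → IsPNilpotent p (normalizer (H : Set G)))
    (P : Sylow p G) {x g : G} (hx : x ∈ P) (hg : g * x * g⁻¹ ∈ P) :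
    ∃ u ∈ P, g * x * g⁻¹ = u * x * u⁻¹ := by
  by_cases hbot : (P : Subgroup G) = ⊥
  · have hx1 : x = 1 := Subgroup.mem_bot.1 (hbot ▸ hx)
    exact ⟨1, one_mem _, by simp [hx1]⟩
  obtain ⟨c, hc, hcP⟩ := Sylow.exists_mem_centralizer_inf_smul_eq h (g • P) P
  have hcy : g * x * g⁻¹ * c = c * (g * x * g⁻¹) := mem_centralizer_iff.1 hc _
    ⟨(Sylow.mem_smul_iff _ _ _).2 (by simpa [mul_assoc] using hx), hg⟩
  rw [← mul_smul, Sylow.smul_eq_iff_mem_normalizer] at hcP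
  obtain ⟨M, hM, hMp, k, hk⟩ := h P P.2 hbot
  have htop := Subgroup.sup_eq_top_of_pComplement hk (P.subtype le_normalizer)
  have hmem : (⟨c * g, hcP⟩ : normalizer (P : Set G)) ∈
      M ⊔ (P.subtype le_normalizer : Sylow p (normalizer (P : Set G))) := by
    rw [htop]
    trivial
  obtain ⟨m, hm, u, hu, hmu⟩ := Subgroup.mem_sup_of_normal_left.1 hmem
  have hmu' : (m : G) * u = c * g := congrArg Subtype.val hmu
  have hu' : (u : G) ∈ P := hu
  refine ⟨u, hu', ?_⟩
  have hux : (u : G) * x * (u : G)⁻¹ ∈ P := mul_mem (mul_mem hu' hx) (inv_mem hu')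
  have : ((P : Subgroup G).subgroupOf (normalizer (P : Set G))).Normal :=
    Subgroup.normal_in_normalizer (H := (P : Subgroup G))
  have hcomm := commute_of_normal_of_disjoint
    ((P : Subgroup G).subgroupOf (normalizer (P : Set G))) M inferInstance hM
    (IsPGroup.disjoint_of_not_dvd P.2.comap_subtype hMp)
    ⟨(u : G) * x * (u : G)⁻¹, le_normalizer hux⟩ m hux hm
  have hcomm' : ((u : G) * x * (u : G)⁻¹) * m = m * ((u : G) * x * (u : G)⁻¹) :=
    congrArg Subtype.val hcomm
  have h1 : g * x * g⁻¹ = (c * g) * x * (c * g)⁻¹ := by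
    rw [eq_comm, mul_inv_rev]
    calc c * g * x * (g⁻¹ * c⁻¹) = c * (g * x * g⁻¹) * c⁻¹ := by simp only [mul_assoc]
      _ = g * x * g⁻¹ := by rw [← hcy, mul_inv_cancel_right]
  rw [h1, ← hmu', mul_inv_rev]
  calc (m : G) * u * x * ((u : G)⁻¹ * (m : G)⁻¹)
      = m * (u * x * (u : G)⁻¹) * (m : G)⁻¹ := by simp only [mul_assoc]
    _ = u * x * (u : G)⁻¹ := by rw [← hcomm', mul_inv_cancel_right]

/-- **Frobenius' normal `p`-complement theorem**: if all normalizers of nontrivial `p`-subgroups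
are `p`-nilpotent, then so is the group. -/
theorem IsPNilpotent.of_normalizer
    (h : ∀ H : Subgroup G, IsPGroup p H → H ≠ ⊥ → IsPNilpotent p (normalizer (H : Set G))) :
    IsPNilpotent p G := by
  induction hn : Nat.card G using Nat.strong_induction_on generalizing G with
  | _ n ih =>
  let P : Sylow p G := default
  by_cases hbot : (P : Subgroup G) = ⊥
  · refine ⟨⊤, inferInstance, ?_, 0, by simp⟩
    have := P.not_dvd_index
    rwa [hbot, Subgroup.index_bot, ← Subgroup.card_top] at this
  have hPnt : Nontrivial P := (Subgroup.nontrivial_iff_ne_bot _).2 hbot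
  have hfoc : (P : Subgroup G).focalSubgroupOf ≤ _root_.commutator P := by
    rw [focalSubgroupOf_eq_closure, closure_le]
    rintro ⟨y, hy⟩ ⟨x, hx, u, hyx⟩
    simp only at hyx
    subst hyx
    have hu : u * x⁻¹ * u⁻¹ ∈ P := by
      have := mul_mem (inv_mem hx) hy
      rwa [commutatorElement_def, ← mul_assoc, ← mul_assoc, ← mul_assoc, inv_mul_cancel,
        one_mul] at this
    obtain ⟨v, hv, huv⟩ := Sylow.exists_mem_conj_eq h P (inv_mem hx) hu
    have : (⟨⁅x, u⁆, hy⟩ : P) = ⁅(⟨x, hx⟩ : P), (⟨v, hv⟩ : P)⁆ := by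
      apply Subtype.ext
      simp only [commutatorElement_def, mul_assoc] at huv ⊢
      rw [huv]
      rfl
    rw [SetLike.mem_coe, this]
    exact commutator_mem_commutator (mem_top _) (mem_top _)
  have : Group.IsNilpotent P := P.2.isNilpotent
  have hlt := lt_of_le_of_lt hfoc (Group.IsSolvable.commutator_lt_top_of_nontrivial P)
  set K := (P : Subgroup G).transferFocal.ker with hK
  have hindex : ∃ j, K.index = p ^ j := by
    rw [hK, Subgroup.index_ker]
    exact IsPGroup.iff_card.1 ((P.2.to_quotient _).to_subgroup _)
  obtain ⟨j, hj⟩ := hindex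
  have hKtop : K ≠ ⊤ := by
    intro htop
    have h1 := ker_transferFocal_inf_eq_focalSubgroup P
    rw [← hK, htop, top_inf_eq] at h1
    apply hlt.ne
    rw [focalSubgroupOf, ← h1]
    simp
  refine IsPNilpotent.of_normal_of_index (K := K) ?_ hj
  refine ih _ ?_ (fun H hH hHbot => ?_) rfl
  · rw [← hn, ← Subgroup.card_mul_index K]
    exact (Nat.lt_mul_iff_one_lt_right Nat.card_pos).2 (Subgroup.one_lt_index_of_ne_top hKtop)
  · have h1 := h (H.map K.subtype) (hH.map _)
      (by rwa [Ne, Subgroup.map_eq_bot_iff_of_injective _ K.subtype_injective])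
    have h2 : (normalizer (H : Set K)).map K.subtype ≤
        normalizer ((H.map K.subtype : Subgroup G) : Set G) := le_normalizer_map K.subtype
    refine (h1.of_le h2).of_injective
      ((normalizer (H : Set K)).equivMapOfInjective _ K.subtype_injective).toMonoidHom
      (MulEquiv.injective _)

end Frobenius

/-- If an abelian group acts on `Λ` so that `p ^ (|Λ| - number of orbits)` is at most the size of
the acting quotient, where `2 < p`, then the action is trivial. -/
theorem MulAction.smul_eq_of_pow_card_sub_le {A Λ : Type*} [Group A] [Finite A]
    [MulAction A Λ] [Finite Λ] (hA : ∀ a b : A, a * b = b * a) {p : ℕ} (hp : 2 < p)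
    (B : Subgroup A) (hB : ∀ a : A, (∀ l : Λ, a • l = l) → a ∈ B)
    (h : p ^ (Nat.card Λ - Nat.card (MulAction.orbitRel.Quotient A Λ)) ≤ B.index)
    (a : A) (l : Λ) : a • l = l := by
  classical
  have := Fintype.ofFinite Λ
  have := Fintype.ofFinite (MulAction.orbitRel.Quotient A Λ)
  let n : MulAction.orbitRel.Quotient A Λ → ℕ := fun o => Nat.card o.orbit
  have hn : ∀ o, 1 ≤ n o := fun o => by
    have : Nonempty o.orbit := ⟨⟨o.out, MulAction.orbitRel.Quotient.mem_orbit.2 o.out_eq⟩⟩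
    exact Nat.card_pos
  have hindex : B.index ≤ ∏ o, n o := by
    have h1 : B.index ≤ (MulAction.toPermHom A Λ).ker.index := by
      refine Nat.le_of_dvd (Nat.pos_of_ne_zero Subgroup.index_ne_zero_of_finite)
        (Subgroup.index_dvd_of_le fun a ha => hB a fun l => ?_)
      exact congrFun (congrArg DFunLike.coe (MonoidHom.mem_ker.1 ha)) l
    refine h1.trans ?_
    rw [Subgroup.index_ker, ← Nat.card_pi]
    let f : (MulAction.toPermHom A Λ).range → (o : MulAction.orbitRel.Quotient A Λ) → o.orbit :=
      fun s o => ⟨(s : Equiv.Perm Λ) o.out, by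
        obtain ⟨_, a, rfl⟩ := s
        rw [MulAction.orbitRel.Quotient.mem_orbit]
        refine Eq.trans (Quotient.sound ?_) o.out_eq
        exact ⟨a, rfl⟩⟩
    refine Nat.card_le_card_of_injective f ?_
    rintro ⟨_, a, rfl⟩ ⟨_, b, rfl⟩ hab
    refine Subtype.ext (Equiv.ext fun l => ?_)
    have h2 : a • (Quotient.mk (MulAction.orbitRel A Λ) l).out =
        b • (Quotient.mk (MulAction.orbitRel A Λ) l).out :=
      congrArg Subtype.val (congrFun hab (Quotient.mk (MulAction.orbitRel A Λ) l))
    obtain ⟨c, hc⟩ := MulAction.orbitRel_apply.1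
      (Setoid.symm' _ (Quotient.mk_out (s := MulAction.orbitRel A Λ) l))
    have hc : c • (Quotient.mk (MulAction.orbitRel A Λ) l).out = l := hc
    change a • l = b • l
    rw [← hc, ← mul_smul, ← mul_smul, hA a c, hA b c, mul_smul, mul_smul, h2]
  have hsum : Nat.card Λ = ∑ o, n o := by
    rw [← Nat.card_sigma]
    exact Nat.card_congr (MulAction.selfEquivSigmaOrbits' A Λ)
  have hsub : Nat.card Λ - Nat.card (MulAction.orbitRel.Quotient A Λ) = ∑ o, (n o - 1) := by
    rw [hsum, Nat.card_eq_fintype_card, Finset.sum_tsub_distrib _ fun o _ => hn o]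
    simp
  rw [hsub, ← Finset.prod_pow_eq_pow_sum] at h
  have hpow : ∀ m : ℕ, m + 2 < p ^ (m + 1) := by
    intro m
    induction m with
    | zero => simpa using hp
    | succ m ih =>
      rw [pow_succ]
      nlinarith
  have hle : ∀ o, n o ≤ p ^ (n o - 1) := by
    intro o
    rcases Nat.lt_or_ge 1 (n o) with h1 | h1
    · obtain ⟨m, hm⟩ := Nat.exists_eq_add_of_le' h1
      rw [hm]
      exact (hpow m).le
    · rw [le_antisymm h1 (hn o)]
      simp
  by_contra hne
  have hlt : ∏ o, n o < ∏ o, p ^ (n o - 1) := by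
    refine Finset.prod_lt_prod (fun o _ => hn o) (fun o _ => hle o)
      ⟨Quotient.mk (MulAction.orbitRel A Λ) l, Finset.mem_univ _, ?_⟩
    have h1 : 1 < n (Quotient.mk (MulAction.orbitRel A Λ) l) := by
      rw [Finite.one_lt_card_iff_nontrivial]
      refine ⟨⟨a • l, ?_⟩, ⟨l, ?_⟩, fun h => hne (congrArg Subtype.val h)⟩
      · rw [MulAction.orbitRel.Quotient.mem_orbit]
        exact Quotient.sound ⟨a, rfl⟩
      · rw [MulAction.orbitRel.Quotient.mem_orbit]
    obtain ⟨m, hm⟩ := Nat.exists_eq_add_of_le' h1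
    rw [hm]
    exact hpow m
  exact absurd (h.trans hindex) (not_le_of_gt hlt)

/-- A group permuting an independent family of nonzero subspaces has a space of fixed vectors of
codimension at least the size of the family minus the number of orbits. -/
theorem Representation.finrank_add_card_sub_card_orbits_le {k W A Λ : Type*} [Field k]
    [AddCommGroup W] [Module k W] [FiniteDimensional k W] [Group A] [MulAction A Λ] [Finite Λ]
    (ρ : A →* Module.End k W) (E : Λ → Submodule k W) (hE : iSupIndep E) (hE0 : ∀ l, E l ≠ ⊥)
    (hρ : ∀ a l, ∀ w ∈ E l, ρ a w ∈ E (a • l))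
    (F : Submodule k W) (hF : ∀ w ∈ F, ∀ a, ρ a w = w) :
    Module.finrank k F + (Nat.card Λ - Nat.card (MulAction.orbitRel.Quotient A Λ)) ≤
      Module.finrank k W := by
  classical
  have := Fintype.ofFinite Λ
  have := Fintype.ofFinite (MulAction.orbitRel.Quotient A Λ)
  let r : Λ → Λ := fun l => (Quotient.mk (MulAction.orbitRel A Λ) l).out
  have hrr : ∀ l, r (r l) = r l := fun l => congrArg Quotient.out (Quotient.out_eq _)
  have hr : ∀ l, ∃ a : A, a • l = r l := fun l =>
    MulAction.orbitRel_apply.1 (Quotient.mk_out (s := MulAction.orbitRel A Λ) l)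
  have hra : ∀ (a : A) l, r (a • l) = r l := fun a l =>
    congrArg Quotient.out (Quotient.sound (s := MulAction.orbitRel A Λ) ⟨a, rfl⟩)
  have hcard : Nat.card Λ - Nat.card (MulAction.orbitRel.Quotient A Λ) =
      Fintype.card {l // r l ≠ l} := by
    have h1 : Nat.card (MulAction.orbitRel.Quotient A Λ) = Fintype.card {l // r l = l} := by
      rw [← Nat.card_eq_fintype_card]
      refine Nat.card_congr ⟨fun o => ⟨o.out, ?_⟩, fun l => Quotient.mk _ l.1, fun o => o.out_eq,
        fun l => Subtype.ext l.2⟩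
      exact congrArg Quotient.out o.out_eq
    rw [h1, Nat.card_eq_fintype_card, Fintype.card_subtype_compl]
  choose v hv hv0 using fun l => Submodule.exists_mem_ne_zero_of_ne_bot (hE0 l)
  have hli : LinearIndependent k (fun l : {l // r l ≠ l} => v l) :=
    (hE.linearIndependent E hv hv0).comp _ Subtype.val_injective
  have hdisj : Disjoint F (Submodule.span k (Set.range fun l : {l // r l ≠ l} => v l)) := by
    rw [Submodule.disjoint_def]
    intro w hw hwU
    obtain ⟨c, rfl⟩ := (Submodule.mem_span_range_iff_exists_fun k).1 hwU
    refine Finset.sum_eq_zero fun l₀ _ => ?_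
    obtain ⟨a, ha⟩ := hr l₀
    have h1 := hF _ hw a
    rw [map_sum, ← Finset.add_sum_erase _ _ (Finset.mem_univ l₀)] at h1
    have h2 : ρ a (c l₀ • v l₀) ∈ E (r l₀) := ha ▸ hρ a _ _ (Submodule.smul_mem _ _ (hv _))
    have hmem : ∀ (m : Λ) (w : W), m ≠ r l₀ → w ∈ E m → w ∈ ⨆ j, ⨆ (_ : j ≠ r l₀), E j :=
      fun m w hm hw => Submodule.mem_iSup_of_mem m (Submodule.mem_iSup_of_mem hm hw)
    have h3 : ρ a (c l₀ • v l₀) ∈ ⨆ j, ⨆ (_ : j ≠ r l₀), E j := by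
      rw [eq_sub_of_add_eq h1]
      refine Submodule.sub_mem _ (Submodule.sum_mem _ fun m _ => ?_)
        (Submodule.sum_mem _ fun m hm => ?_)
      · refine hmem m _ (fun h => m.2 ?_) (Submodule.smul_mem _ _ (hv _))
        rw [h, hrr]
      · refine hmem (a • m) _ (fun h => Finset.ne_of_mem_erase hm (Subtype.ext ?_))
          (hρ a _ _ (Submodule.smul_mem _ _ (hv _)))
        rw [← ha] at h
        exact smul_left_cancel a h
    have h4 := (Submodule.disjoint_def.1 (hE (r l₀))) _ h2 h3
    have h5 : ρ a⁻¹ (ρ a (c l₀ • v l₀)) = c l₀ • v l₀ := by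
      rw [← Module.End.mul_apply, ← map_mul, inv_mul_cancel, map_one, Module.End.one_apply]
    rw [← h5, h4, map_zero]
  rw [hcard, ← finrank_span_eq_card hli, ← Submodule.finrank_sup_add_finrank_inf_eq,
    disjoint_iff.1 hdisj, finrank_bot, add_zero]
  exact Submodule.finrank_le _

theorem Representation.conj_eq_of_isAlgClosed {k W G : Type*} [Field k] [IsAlgClosed k] {p : ℕ}
    [CharP k p] (hp : 2 < p) [AddCommGroup W] [Module k W] [FiniteDimensional k W] [Group G]
    (ρ : G →* Module.End k W) (K A : Subgroup G) [hK : K.Normal] [Finite A]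
    (hA : ∀ a ∈ A, ∀ b ∈ A, a * b = b * a)
    (hcomm : ∀ x ∈ K, ∀ y ∈ K, ρ x * ρ y = ρ y * ρ x)
    (hord : ∀ x ∈ K, ∃ n : ℕ, ¬ p ∣ n ∧ ρ x ^ n = 1)
    (B : Subgroup G) (hB : ∀ a ∈ A, (∀ x ∈ K, ρ (a * x * a⁻¹) = ρ x) → a ∈ B)
    (F : Submodule k W) (hF : ∀ w ∈ F, ∀ a ∈ A, ρ a w = w)
    (h : p ^ (Module.finrank k W - Module.finrank k F) ≤ B.relIndex A) :
    ∀ a ∈ A, ∀ x ∈ K, ρ (a * x * a⁻¹) = ρ x := by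
  classical
  have hmul : ∀ (a b : G) w, ρ (a * b) w = ρ a (ρ b w) := fun a b w => by
    rw [map_mul, Module.End.mul_apply]
  let E : (K → k) → Submodule k W := fun χ => ⨅ x : K, (ρ x).maxGenEigenspace (χ x)
  have hE : ∀ (χ : K → k) w, w ∈ E χ ↔ ∀ x : K, ρ x w = χ x • w := by
    intro χ w
    rw [Submodule.mem_iInf]
    refine forall_congr' fun x => ?_
    obtain ⟨n, hn, hxn⟩ := hord x x.2
    have hs : (ρ x).IsSemisimple := by
      refine Module.End.isSemisimple_of_squarefree_aeval_eq_zero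
        (p := Polynomial.X ^ n - 1) (Polynomial.Separable.squarefree
        (Polynomial.X_pow_sub_one_separable_iff.2 ?_)) (by simp [hxn])
      rwa [Ne, CharP.cast_eq_zero_iff k p]
    rw [hs.isFinitelySemisimple.maxGenEigenspace_eq_eigenspace, Module.End.mem_eigenspace_iff]
  have hind : iSupIndep E := Module.End.independent_iInf_maxGenEigenspace_of_forall_mapsTo _
    fun i j φ => Module.End.mapsTo_maxGenEigenspace_of_comm (hcomm j j.2 i i.2) φ
  have htop : ⨆ χ, E χ = ⊤ :=
    Module.End.iSup_iInf_maxGenEigenspace_eq_top_of_iSup_maxGenEigenspace_eq_top_of_commute _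
      (fun i j _ => hcomm i i.2 j j.2) fun i => Module.End.iSup_maxGenEigenspace_eq_top _
  let tw : A → (K → k) → (K → k) := fun a χ x => χ (MulAut.conjNormal (a : G)⁻¹ x)
  have htw : ∀ (a : A) χ w, w ∈ E χ → ρ a w ∈ E (tw a χ) := by
    intro a χ w hw
    rw [hE] at hw ⊢
    intro x
    have := hw (MulAut.conjNormal (a : G)⁻¹ x)
    change _ = χ (MulAut.conjNormal (a : G)⁻¹ x) • _
    rw [MulAut.conjNormal_apply] at this
    rw [← map_smul, ← this, ← hmul, ← hmul]
    congr 2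
    group
  let Λ := {χ : K → k // E χ ≠ ⊥}
  have : Finite Λ := @Finite.of_fintype _ hind.fintypeNeBotOfFiniteDimensional
  have htw0 : ∀ (a : A) (χ : Λ), E (tw a χ.1) ≠ ⊥ := by
    intro a χ h0
    obtain ⟨w, hw, hw0⟩ := Submodule.exists_mem_ne_zero_of_ne_bot χ.2
    have h1 := htw a _ w hw
    rw [h0, Submodule.mem_bot] at h1
    apply hw0
    have h2 := hmul (a : G)⁻¹ a w
    rwa [h1, map_zero, inv_mul_cancel, map_one, Module.End.one_apply] at h2
  let _ : MulAction A Λ :=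
    { smul := fun a χ => ⟨tw a χ.1, htw0 a χ⟩
      one_smul := fun χ => Subtype.ext (funext fun x => congrArg χ.1 (Subtype.ext (by
        simp only [MulAut.conjNormal_apply]
        simp)))
      mul_smul := fun a b χ => Subtype.ext (funext fun x => congrArg χ.1 (Subtype.ext (by
        simp only [MulAut.conjNormal_apply]
        push_cast
        group))) }
  have hfix : ∀ a : A, (∀ l : Λ, a • l = l) → ∀ x ∈ K, ρ (a * x * (a : G)⁻¹) = ρ x := by
    intro a ha x hx
    have hle : (⊤ : Submodule k W) ≤ LinearMap.eqLocus (ρ (a * x * (a : G)⁻¹)) (ρ x) := by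
      rw [← htop, iSup_le_iff]
      intro χ
      by_cases h0 : E χ = ⊥
      · rw [h0]
        exact bot_le
      intro w hw
      have hax : (a * x * (a : G)⁻¹) ∈ K := hK.conj_mem x hx a
      have h1 : tw a χ = χ := congrArg Subtype.val (ha ⟨χ, h0⟩)
      have h2 : χ ⟨a * x * (a : G)⁻¹, hax⟩ = χ ⟨x, hx⟩ := by
        rw [← congrFun h1]
        refine congrArg χ (Subtype.ext ?_)
        simp only [MulAut.conjNormal_apply]
        group
      rw [hE] at hw
      change ρ _ w = ρ x w
      rw [hw ⟨_, hax⟩, hw ⟨x, hx⟩, h2]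
    exact LinearMap.ext fun w => hle (Submodule.mem_top (x := w))
  intro a ha x hx
  refine hfix ⟨a, ha⟩ (fun l => ?_) x hx
  refine MulAction.smul_eq_of_pow_card_sub_le (fun a b => Subtype.ext (hA a a.2 b b.2)) hp
    (B.subgroupOf A) (fun a ha => ?_) (le_trans (Nat.pow_le_pow_right (by lia) ?_) h) _ l
  · exact Subgroup.mem_subgroupOf.2 (hB a a.2 (hfix a ha))
  · have := Representation.finrank_add_card_sub_card_orbits_le (ρ.comp A.subtype)
      (fun l : Λ => E l.1) (hind.comp Subtype.val_injective) (fun l => l.2)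
      (fun a l w hw => htw a l.1 w hw) F (fun w hw a => hF w hw a a.2)
    omega

theorem Representation.conj_eq_of_charP {k W G : Type*} [Field k] {p : ℕ}
    [CharP k p] (hp : 2 < p) [AddCommGroup W] [Module k W] [FiniteDimensional k W] [Group G]
    (ρ : G →* Module.End k W) (K A : Subgroup G) [K.Normal] [Finite A]
    (hA : ∀ a ∈ A, ∀ b ∈ A, a * b = b * a)
    (hcomm : ∀ x ∈ K, ∀ y ∈ K, ρ x * ρ y = ρ y * ρ x)
    (hord : ∀ x ∈ K, ∃ n : ℕ, ¬ p ∣ n ∧ ρ x ^ n = 1)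
    (B : Subgroup G) (hB : ∀ a ∈ A, (∀ x ∈ K, ρ (a * x * a⁻¹) = ρ x) → a ∈ B)
    (F : Submodule k W) (hF : ∀ w ∈ F, ∀ a ∈ A, ρ a w = w)
    (h : p ^ (Module.finrank k W - Module.finrank k F) ≤ B.relIndex A) :
    ∀ a ∈ A, ∀ x ∈ K, ρ (a * x * a⁻¹) = ρ x := by
  let k' := AlgebraicClosure k
  let φ : Module.End k W →* Module.End k' (TensorProduct k k' W) :=
    (Module.End.baseChangeHom k k' W : _ →* _)
  have hφ : Function.Injective φ := LinearMap.baseChangeHom_injective k W k'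
  have : CharP k' p := charP_of_injective_algebraMap (algebraMap k k').injective p
  have hinj : Function.Injective (F.subtype.baseChange k') :=
    Module.Flat.lTensor_preserves_injective_linearMap F.subtype F.subtype_injective
  have key := Representation.conj_eq_of_isAlgClosed (k := k') hp (φ.comp ρ) K A hA
    (fun x hx y hy => ?_) (fun x hx => ?_) B (fun a ha hax => hB a ha fun x hx => hφ (hax x hx))
    (LinearMap.range (F.subtype.baseChange k')) (fun w hw a ha => ?_) ?_
  · exact fun a ha x hx => hφ (key a ha x hx)
  · simp only [MonoidHom.comp_apply]
    rw [← map_mul, hcomm x hx y hy, map_mul]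
  · obtain ⟨n, hn, hx⟩ := hord x hx
    refine ⟨n, hn, ?_⟩
    rw [MonoidHom.comp_apply, ← map_pow, hx, map_one]
  · obtain ⟨t, rfl⟩ := hw
    change (ρ a).baseChange k' (F.subtype.baseChange k' t) = F.subtype.baseChange k' t
    rw [← LinearMap.comp_apply, ← LinearMap.baseChange_comp]
    congr 2
    exact LinearMap.ext fun w => hF w w.2 a ha
  · rwa [LinearMap.finrank_range_of_inj hinj, Module.finrank_baseChange, Module.finrank_baseChange]

theorem Subgroup.commutator_mem_centralizer_of_relIndex_le {G : Type*} [Group G] [Finite G] {p : ℕ}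
    [hp : Fact p.Prime] (hp2 : 2 < p) (V K A B : Subgroup G) [V.Normal] [K.Normal]
    (hV : ∀ v ∈ V, ∀ w ∈ V, v * w = w * v) (hVp : ∀ v ∈ V, v ^ p = 1)
    (hA : ∀ a ∈ A, ∀ b ∈ A, a * b = b * a)
    (hcomm : ∀ x ∈ K, ∀ y ∈ K, (x * y) * (y * x)⁻¹ ∈ centralizer (V : Set G))
    (hord : ∀ x ∈ K, ∃ n : ℕ, ¬ p ∣ n ∧ x ^ n ∈ centralizer (V : Set G))
    (hB : ∀ a ∈ A, (∀ x ∈ K, (a * x * a⁻¹) * x⁻¹ ∈ centralizer (V : Set G)) → a ∈ B)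
    (h : (centralizer (A : Set G)).relIndex V ≤ B.relIndex A) :
    ∀ a ∈ A, ∀ x ∈ K, (a * x * a⁻¹) * x⁻¹ ∈ centralizer (V : Set G) := by
  let _ : CommGroup V := { mul_comm := fun v w => Subtype.ext (hV v v.2 w w.2) }
  let _ : Module (ZMod p) (Additive V) := AddCommGroup.zmodModule (n := p)
    fun v => Subtype.ext (hVp v.toMul v.toMul.2)
  let ρ : G →* Module.End (ZMod p) (Additive V) :=
    { toFun := fun g => ((MulAut.conjNormal g : MulAut V).toMonoidHom.toAdditive).toZModLinearMap p
      map_one' := LinearMap.ext fun v => Subtype.ext (by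
        change 1 * (v.toMul : G) * 1⁻¹ = v.toMul
        group)
      map_mul' := fun a b => LinearMap.ext fun v => Subtype.ext (by
        change a * b * (v.toMul : G) * (a * b)⁻¹ = a * (b * v.toMul * b⁻¹) * a⁻¹
        group) }
  have hρ : ∀ g (v : Additive V), ((ρ g v).toMul : G) = g * v.toMul * g⁻¹ := fun g v => rfl
  have hρ1 : ∀ g, ρ g = 1 ↔ g ∈ centralizer (V : Set G) := by
    intro g
    rw [mem_centralizer_iff]
    constructor
    · intro hg v hv
      have := hρ g (Additive.ofMul ⟨v, hv⟩)
      rw [hg] at this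
      exact eq_mul_inv_iff_mul_eq.1 this
    · intro hg
      refine LinearMap.ext fun v => Subtype.ext ?_
      change g * (v.toMul : G) * g⁻¹ = v.toMul
      rw [← hg _ v.toMul.2, mul_inv_cancel_right]
  have hρ2 : ∀ g h, ρ g = ρ h ↔ g * h⁻¹ ∈ centralizer (V : Set G) := by
    intro g h
    have hinv : ρ h * ρ h⁻¹ = 1 := by rw [← map_mul, mul_inv_cancel, map_one]
    have hinv' : ρ h⁻¹ * ρ h = 1 := by rw [← map_mul, inv_mul_cancel, map_one]
    rw [← hρ1, map_mul]
    constructor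
    · intro hgh
      rw [hgh, hinv]
    · intro hgh
      rw [← mul_one (ρ g), ← hinv', ← mul_assoc, hgh, one_mul]
  let F : Submodule (ZMod p) (Additive V) := ⨅ a : A, LinearMap.eqLocus (ρ a) 1
  have hF : ∀ v : Additive V, v ∈ F ↔ (v.toMul : G) ∈ centralizer (A : Set G) := by
    intro v
    rw [Submodule.mem_iInf, mem_centralizer_iff]
    constructor
    · intro hv a ha
      have h1 : a * (v.toMul : G) * a⁻¹ = v.toMul := congrArg Subtype.val (hv ⟨a, ha⟩)
      exact mul_inv_eq_iff_eq_mul.1 h1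
    · intro hv a
      refine Subtype.ext ?_
      change a * (v.toMul : G) * (a : G)⁻¹ = v.toMul
      rw [hv a a.2, mul_inv_cancel_right]
  have hcard : p ^ (Module.finrank (ZMod p) (Additive V) - Module.finrank (ZMod p) F) =
      (centralizer (A : Set G)).relIndex V := by
    have h1 : Nat.card V = p ^ Module.finrank (ZMod p) (Additive V) := by
      have := Module.natCard_eq_pow_finrank (K := ZMod p) (V := Additive V)
      rwa [Nat.card_zmod] at this
    have h2 : Nat.card (((centralizer (A : Set G)).subgroupOf V : Subgroup V)) =
        p ^ Module.finrank (ZMod p) F := by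
      have := Module.natCard_eq_pow_finrank (K := ZMod p) (V := F)
      rw [Nat.card_zmod] at this
      rw [← this]
      exact Nat.card_congr (Equiv.subtypeEquiv Additive.ofMul fun v => (hF (Additive.ofMul v)).symm)
    have h3 := ((centralizer (A : Set G)).subgroupOf V).card_mul_index
    rw [h1, h2, ← Nat.add_sub_cancel' (Submodule.finrank_le F), pow_add] at h3
    exact (Nat.eq_of_mul_eq_mul_left (Nat.pow_pos hp.out.pos) h3).symm
  have key := Representation.conj_eq_of_charP hp2 ρ K A hA (fun x hx y hy => ?_)
    (fun x hx => ?_) B (fun a ha hax => hB a ha fun x hx => (hρ2 _ _).1 (hax x hx)) F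
    (fun w hw a ha => ?_) (hcard ▸ h)
  · exact fun a ha x hx => (hρ2 _ _).1 (key a ha x hx)
  · rw [← map_mul, ← map_mul, hρ2]
    exact hcomm x hx y hy
  · obtain ⟨n, hn, hx⟩ := hord x hx
    exact ⟨n, hn, by rw [← map_pow, hρ1]; exact hx⟩
  · exact (Submodule.mem_iInf _).1 hw ⟨a, ha⟩

/-- The normalizers of (the images of) the nontrivial characteristic subgroups of the source of `i`
are `p`-nilpotent. -/
def IsLocallyPNilpotent (p : ℕ) {P G : Type*} [Group P] [Group G] (i : P →* G) : Prop :=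
  ∀ X : Subgroup P, X.Characteristic → X ≠ ⊥ →
    IsPNilpotent p (normalizer ((X.map i : Subgroup G) : Set G))

theorem Subgroup.Characteristic.comap_mulEquiv {P Q : Type*} [Group P] [Group Q] (e : P ≃* Q)
    {X : Subgroup Q} (hX : X.Characteristic) : (X.comap e.toMonoidHom).Characteristic := by
  rw [characteristic_iff_comap_eq] at hX ⊢
  intro φ
  conv_rhs => rw [← hX ((e.symm.trans φ).trans e)]
  rw [comap_comap, comap_comap]
  congr 1
  ext x
  simp

theorem Subgroup.mem_normalizer_of_forall_mem {G : Type*} [Group G] {H : Subgroup G} {g : G}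
    (h : ∀ x ∈ H, g * x * g⁻¹ ∈ H) (h' : ∀ x ∈ H, g⁻¹ * x * g ∈ H) :
    g ∈ normalizer (H : Set G) := by
  rw [mem_normalizer_iff]
  refine fun x => ⟨h x, fun hx => ?_⟩
  have := h' _ hx
  rwa [show g⁻¹ * (g * x * g⁻¹) * g = x by group] at this

theorem Subgroup.normalizer_le_normalizer_map {G : Type*} [Group G] {S : Subgroup G}
    {X : Subgroup S} (hX : X.Characteristic) :
    normalizer (S : Set G) ≤ normalizer ((X.map S.subtype : Subgroup G) : Set G) := by
  have key : ∀ g ∈ normalizer (S : Set G), ∀ x ∈ X.map S.subtype, g * x * g⁻¹ ∈ X.map S.subtype := by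
    rintro g hg _ ⟨x, hx, rfl⟩
    exact ⟨S.normalizerMonoidHom ⟨g, hg⟩ x,
      characteristic_iff_le_comap.1 hX (S.normalizerMonoidHom ⟨g, hg⟩) hx, rfl⟩
  intro g hg
  refine mem_normalizer_of_forall_mem (key g hg) fun x hx => ?_
  have := key g⁻¹ (inv_mem hg) x hx
  rwa [inv_inv] at this

theorem IsLocallyPNilpotent.of_equiv {p : ℕ} {P Q G : Type*} [Group P] [Group Q] [Group G]
    {i : P →* G} {j : Q →* G} (e : P ≃* Q) (hij : ∀ x, j (e x) = i x)
    (h : IsLocallyPNilpotent p i) : IsLocallyPNilpotent p j := by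
  intro X hX hX0
  have h1 := h _ (hX.comap_mulEquiv e) fun h0 => hX0 ?_
  · have h2 : (X.comap e.toMonoidHom).map i = X.map j := by
      ext g
      constructor
      · rintro ⟨x, hx, rfl⟩
        exact ⟨e x, hx, hij x⟩
      · rintro ⟨x, hx, rfl⟩
        refine ⟨e.symm x, ?_, ?_⟩
        · change e (e.symm x) ∈ X
          rwa [e.apply_symm_apply]
        · rw [← hij, e.apply_symm_apply]
    rwa [h2] at h1
  · rw [eq_bot_iff]
    intro x hx
    have : e.symm x ∈ X.comap e.toMonoidHom := by
      change e (e.symm x) ∈ X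
      rwa [e.apply_symm_apply]
    rw [h0, mem_bot] at this
    rw [mem_bot, ← e.apply_symm_apply x, this, map_one]

theorem IsLocallyPNilpotent.range {p : ℕ} {P G : Type*} [Group P] [Group G]
    {i : P →* G} (hi : Function.Injective i) (h : IsLocallyPNilpotent p i) :
    IsLocallyPNilpotent p i.range.subtype :=
  h.of_equiv (MonoidHom.ofInjective hi) fun _ => rfl

section Thompson

variable {p : ℕ} [hp : Fact p.Prime]

theorem IsLocallyPNilpotent.of_comp {P M G : Type*} [Group P] [Group M] [Group G] [Finite G]
    {i : P →* M} {f : M →* G} (hf : Function.Injective f)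
    (h : IsLocallyPNilpotent p (f.comp i)) : IsLocallyPNilpotent p i := by
  have : Finite M := Finite.of_injective f hf
  intro X hX hX0
  have h1 := h X hX hX0
  have h2 : ∀ x : normalizer ((X.map i : Subgroup M) : Set M),
      f x ∈ normalizer ((X.map (f.comp i) : Subgroup G) : Set G) := fun x => by
    rw [← map_map]
    exact le_normalizer_map f (mem_map_of_mem f x.2)
  exact h1.of_injective ((f.comp (normalizer _).subtype).codRestrict _ h2)
    fun x y hxy => Subtype.ext (hf (congrArg Subtype.val hxy))

theorem IsPNilpotent.normalizer_conj {G : Type*} [Group G] [Finite G] {H : Subgroup G} (g : G)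
    (h : IsPNilpotent p (normalizer ((H.map (MulAut.conj g).toMonoidHom : Subgroup G) : Set G))) :
    IsPNilpotent p (normalizer (H : Set G)) :=
  h.of_injective (((MulAut.conj g).toMonoidHom.comp (normalizer _).subtype).codRestrict _
    fun x => le_normalizer_map _ (mem_map_of_mem (MulAut.conj g).toMonoidHom x.2))
    fun _ _ hxy => Subtype.ext ((MulAut.conj g).injective (congrArg Subtype.val hxy))

/-- The statement of Thompson's theorem for all groups of order less than `n`. -/
def ThompsonBelow.{u} (p n : ℕ) : Prop :=
  ∀ ⦃G P : Type u⦄ [Group G] [Group P] [Finite G], Nat.card G < n → ∀ i : P →* G,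
    Function.Injective i → IsPGroup p P → ¬ p ∣ i.range.index → IsLocallyPNilpotent p i →
      IsPNilpotent p G

theorem ThompsonBelow.of_le_of_ne_top.{u} {G : Type u} [Group G] [Finite G]
    (ih : ThompsonBelow.{u} p (Nat.card G)) {P : Sylow p G}
    (hP : IsLocallyPNilpotent p (P : Subgroup G).subtype) {M : Subgroup G}
    (hPM : (P : Subgroup G) ≤ M) (hM : M ≠ ⊤) : IsPNilpotent p M := by
  refine ih ?_ (inclusion hPM) (inclusion_injective hPM) P.isPGroup' ?_
    (IsLocallyPNilpotent.of_comp (f := M.subtype) M.subtype_injective hP)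
  · exact lt_of_le_of_ne (card_le_card_group M) (fun h => hM (card_eq_iff_eq_top M |>.1 h))
  · rw [inclusion_range]
    exact fun h => P.not_dvd_index (h.trans (relIndex_dvd_index_of_le hPM))

/-- A minimal counterexample to Thompson's theorem has a nontrivial normal `p`-subgroup. -/
theorem ThompsonBelow.exists_normal.{u} {G : Type u} [Group G] [Finite G]
    (ih : ThompsonBelow.{u} p (Nat.card G)) {P : Sylow p G}
    (hP : IsLocallyPNilpotent p (P : Subgroup G).subtype) (hG : ¬ IsPNilpotent p G) :
    ∃ H : Subgroup G, H.Normal ∧ IsPGroup p H ∧ H ≠ ⊥ := by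
  classical
  by_contra! hno
  let bad : Set (Subgroup G) :=
    {H | IsPGroup p H ∧ H ≠ ⊥ ∧ ¬ IsPNilpotent p (normalizer (H : Set G))}
  have hbad : bad.Nonempty := by
    by_contra h0
    refine hG (IsPNilpotent.of_normalizer fun H hH hH0 => ?_)
    by_contra h1
    exact h0 ⟨H, hH, hH0, h1⟩
  obtain ⟨H, ⟨hH, hH0, hHN⟩, hmax⟩ := Set.exists_max_image bad
    (fun H => Nat.card (normalizer (H : Set G) ⊓ P : Subgroup G)) (Set.toFinite _) hbad
  set N := normalizer (H : Set G) with hN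
  have hNtop : N ≠ ⊤ := fun h => hH0 (hno H (normalizer_eq_top_iff.1 h) hH)
  let S := N ⊓ (P : Subgroup G)
  have hSp : IsPGroup p S := P.isPGroup'.to_le inf_le_right
  have hSlt : S < P := by
    refine lt_of_le_of_ne inf_le_right fun h => hHN ?_
    exact ih.of_le_of_ne_top hP (h ▸ inf_le_left) hNtop
  have hindex : ¬ p ∣ S.relIndex N := by
    let T : Sylow p N := default
    have hTp : IsPGroup p ((T : Subgroup N).map N.subtype) := T.isPGroup'.map _
    obtain ⟨R, hR⟩ := hTp.exists_le_sylow
    obtain ⟨g, hg⟩ := MulAction.exists_smul_eq G R P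
    have hTS : Nat.card T ≤ Nat.card S := by
      have h1 := hmax (H.map (MulAut.conj g).toMonoidHom) ⟨hH.map _, ?_, fun h => hHN
        (h.normalizer_conj g)⟩
      · refine le_trans ?_ h1
        have h2 : ((T : Subgroup N).map N.subtype).map (MulAut.conj g).toMonoidHom ≤
            normalizer ((H.map (MulAut.conj g).toMonoidHom : Subgroup G) : Set G) ⊓ P := by
          refine le_inf ((map_mono (map_subtype_le _)).trans (le_normalizer_map _)) ?_
          refine (map_mono hR).trans ?_
          rw [← hg]
          exact le_rfl
        have h3 := card_le_of_le h2
        rwa [card_map_of_injective (MulAut.conj g).injective,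
          card_map_of_injective N.subtype_injective] at h3
      · rw [Ne, map_eq_bot_iff_of_injective _ (MulAut.conj g).injective]
        exact hH0
    obtain ⟨T', hT'⟩ := (hSp.comap_of_injective N.subtype N.subtype_injective).exists_le_sylow
    have h4 : S.subgroupOf N = T' := by
      refine eq_of_le_of_card_ge hT' ?_
      rw [Nat.card_congr (subgroupOfEquivOfLe (inf_le_left : S ≤ N)).toEquiv]
      refine le_trans (le_of_eq ?_) hTS
      exact (Sylow.card_eq_multiplicity T').trans (Sylow.card_eq_multiplicity T).symm
    rw [relIndex, h4]
    exact T'.not_dvd_index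
  refine hHN (ih (lt_of_le_of_ne (card_le_card_group N) fun h => hNtop
    ((card_eq_iff_eq_top N).1 h)) (inclusion (inf_le_left : S ≤ N)) (inclusion_injective _) hSp
    (by rwa [inclusion_range]) ?_)
  refine IsLocallyPNilpotent.of_comp (f := N.subtype) N.subtype_injective fun X hX hX0 => ?_
  by_contra hXN
  have h1 := hmax (X.map S.subtype) ⟨(hSp.to_subgroup X).map _, ?_, hXN⟩
  · have : Group.IsNilpotent P := P.isPGroup'.isNilpotent
    have h2 : normalizer (S : Set G) ⊓ P ≤
        normalizer ((X.map S.subtype : Subgroup G) : Set G) ⊓ P := by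
      refine inf_le_inf_right _ ?_
      exact normalizer_le_normalizer_map hX
    have h3 := (lt_normalizer_inf_of_isNilpotent hSlt).trans_le h2
    exact absurd h1 (not_le_of_gt (Set.Finite.card_lt_card (Set.toFinite _) h3))
  · rwa [Ne, map_eq_bot_iff_of_injective _ S.subtype_injective]

end Thompson

theorem Subgroup.relIndex_sup_right_of_normal {G : Type*} [Group G] [Finite G] (A K : Subgroup G)
    [K.Normal] : A.relIndex (A ⊔ K) = A.relIndex K := by
  have h1 := relIndex_mul_relIndex (A ⊓ K) A (A ⊔ K) inf_le_left le_sup_left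
  have h2 := relIndex_mul_relIndex (A ⊓ K) K (A ⊔ K) inf_le_right le_sup_right
  rw [← h2, inf_relIndex_right, inf_relIndex_left, relIndex_sup_right, mul_comm] at h1
  exact Nat.eq_of_mul_eq_mul_right (Nat.pos_of_ne_zero index_ne_zero_of_finite) h1

section Thompson

variable {p : ℕ} [hp : Fact p.Prime] {G : Type*} [Group G] [Finite G]

/-- Two Sylow subgroups of a subgroup `Z` are conjugate in `Z`. -/
theorem IsPGroup.exists_map_conj_eq {Z A B : Subgroup G} (hA : IsPGroup p A) (hB : IsPGroup p B)
    (hAZ : A ≤ Z) (hBZ : B ≤ Z) (hA' : ¬ p ∣ A.relIndex Z) (hB' : ¬ p ∣ B.relIndex Z) :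
    ∃ z ∈ Z, A.map (MulAut.conj z).toMonoidHom = B := by
  obtain ⟨z, hz⟩ := MulAction.exists_smul_eq Z
    ((hA.comap_of_injective Z.subtype Z.subtype_injective).toSylow hA')
    ((hB.comap_of_injective Z.subtype Z.subtype_injective).toSylow hB')
  refine ⟨z, z.2, ?_⟩
  have h1 : ∀ x : Z, (x : G) ∈ B ↔ (z : G)⁻¹ * x * z ∈ A := by
    intro x
    have h2 := Sylow.mem_smul_iff
      ((hA.comap_of_injective Z.subtype Z.subtype_injective).toSylow hA') z x
    rw [hz] at h2
    exact h2
  ext x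
  constructor
  · rintro ⟨a, ha, rfl⟩
    have h3 : (z : G) * a * (z : G)⁻¹ ∈ Z := Z.mul_mem (Z.mul_mem z.2 (hAZ ha)) (Z.inv_mem z.2)
    refine (h1 ⟨_, h3⟩).2 ?_
    change (z : G)⁻¹ * (z * a * (z : G)⁻¹) * z ∈ A
    rwa [show (z : G)⁻¹ * (z * a * (z : G)⁻¹) * z = a by group]
  · intro hx
    exact ⟨_, (h1 ⟨x, hBZ hx⟩).1 hx, by
      change (z : G) * ((z : G)⁻¹ * x * z) * (z : G)⁻¹ = x
      group⟩

/-- A version of the Frattini argument. -/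
theorem IsPGroup.exists_mul_mem_normalizer {Z A : Subgroup G} (hA : IsPGroup p A)
    (hAZ : A ≤ Z) (hA' : ¬ p ∣ A.relIndex Z) {g : G} (hg : g ∈ normalizer (Z : Set G)) :
    ∃ z ∈ Z, z * g ∈ normalizer (A : Set G) := by
  have hB : A.map (MulAut.conj g).toMonoidHom ≤ Z := by
    rintro _ ⟨a, ha, rfl⟩
    exact (mem_normalizer_iff.1 hg a).1 (hAZ ha)
  obtain ⟨z, hz, h⟩ := (hA.map (MulAut.conj g).toMonoidHom).exists_map_conj_eq hA hB hAZ (by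
    have hZ : Z.map (MulAut.conj g).toMonoidHom = Z := mem_normalizer_iff_map_conj_eq.1 hg
    rw [← hZ]
    rwa [relIndex_map_map_of_injective _ _ (MulAut.conj g).injective]) hA'
  refine ⟨z, hz, ?_⟩
  rw [mem_normalizer_iff_map_conj_eq, map_mul]
  rw [map_map] at h
  exact h

/-- A Sylow `p`-subgroup normalizes some Sylow `q`-subgroup of every normal subgroup of order prime
to `p`. -/
theorem Sylow.exists_le_normalizer_of_not_dvd (P : Sylow p G) {K : Subgroup G} [K.Normal]
    (hK : ¬ p ∣ Nat.card K) (q : ℕ) [Fact q.Prime] :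
    ∃ S : Subgroup G, S ≤ K ∧ IsPGroup q S ∧ ¬ q ∣ S.relIndex K ∧
      (P : Subgroup G) ≤ normalizer (S : Set G) := by
  let S : Sylow q K := default
  let S' := (S : Subgroup K).map K.subtype
  have hindex : ¬ p ∣ (normalizer (S' : Set G)).index := by
    have h1 : normalizer (S' : Set G) ⊔ K = ⊤ := S.normalizer_sup_eq_top
    rw [← relIndex_top_right, ← h1, relIndex_sup_right_of_normal]
    exact fun h => hK (h.trans (relIndex_dvd_card _ _))
  obtain ⟨T⟩ : Nonempty (Sylow p (normalizer (S' : Set G))) := inferInstance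
  have hT : ¬ p ∣ ((T : Subgroup (normalizer (S' : Set G))).map (normalizer _).subtype).index := by
    rw [index_map_subtype]
    exact hp.out.prime.not_dvd_mul T.not_dvd_index hindex
  obtain ⟨g, hg⟩ := MulAction.exists_smul_eq G ((T.isPGroup'.map _).toSylow hT) P
  refine ⟨S'.map (MulAut.conj g).toMonoidHom, ?_, (S.isPGroup'.map _).map _, ?_, ?_⟩
  · rintro _ ⟨_, ⟨s, -, rfl⟩, rfl⟩
    exact Normal.conj_mem inferInstance _ s.2 g
  · have hKg : K = K.map (MulAut.conj g).toMonoidHom := (Normal.map_conj_eq K g).symm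
    rw [hKg, relIndex_map_map_of_injective _ _ (MulAut.conj g).injective, relIndex, subgroupOf,
      comap_map_eq_self_of_injective K.subtype_injective]
    exact S.not_dvd_index
  · rw [← hg]
    refine le_trans ?_ (le_normalizer_map (MulAut.conj g).toMonoidHom)
    exact map_mono (map_subtype_le _)

end Thompson

section Thompson

variable {p : ℕ} [hp : Fact p.Prime]

theorem ThompsonBelow.of_normal.{u} {G : Type u} [Group G] [Finite G]
    (ih : ThompsonBelow.{u} p (Nat.card G)) {P : Sylow p G}
    (hP : IsLocallyPNilpotent p (P : Subgroup G).subtype) {K : Subgroup G} [K.Normal]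
    (hK : ¬ p ∣ Nat.card K) (hK0 : K ≠ ⊥) : IsPNilpotent p G := by
  refine IsPNilpotent.of_hom (QuotientGroup.mk' K) (by rwa [QuotientGroup.ker_mk']) ?_
  have hdisj := P.isPGroup'.disjoint_of_not_dvd hK
  refine ih ?_ ((QuotientGroup.mk' K).comp (P : Subgroup G).subtype) ?_ P.isPGroup' ?_ ?_
  · rw [← index_eq_card, ← K.index_mul_card]
    exact lt_mul_of_one_lt_right (Nat.pos_of_ne_zero index_ne_zero_of_finite)
      (K.one_lt_card_iff_ne_bot.2 hK0)
  · rw [injective_iff_map_eq_one]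
    intro x hx
    exact Subtype.ext (disjoint_def.1 hdisj x.2 ((QuotientGroup.eq_one_iff _).1 hx))
  · rw [MonoidHom.range_comp, range_subtype]
    exact fun h => P.not_dvd_index (h.trans (index_map_dvd _ (QuotientGroup.mk'_surjective K)))
  · intro X hX hX0
    rw [← map_map]
    set Y := X.map (P : Subgroup G).subtype with hY
    have hYp : IsPGroup p Y := (P.isPGroup'.to_subgroup X).map _
    have h1 : ∀ x : normalizer (Y : Set G), QuotientGroup.mk' K x ∈
        normalizer ((Y.map (QuotientGroup.mk' K) : Subgroup (G ⧸ K)) : Set (G ⧸ K)) :=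
      fun x => le_normalizer_map _ (mem_map_of_mem _ x.2)
    refine (hP X hX hX0).of_surjective
      (((QuotientGroup.mk' K).comp (normalizer _).subtype).codRestrict _ h1) ?_
    rintro ⟨x, hx⟩
    obtain ⟨g, rfl⟩ := QuotientGroup.mk'_surjective K x
    have hg : g ∈ normalizer ((Y ⊔ K : Subgroup G) : Set G) := by
      have : Y ⊔ K = (Y.map (QuotientGroup.mk' K)).comap (QuotientGroup.mk' K) := by
        rw [comap_map_eq, QuotientGroup.ker_mk']
      rw [this, ← comap_normalizer_eq_of_surjective _ (QuotientGroup.mk'_surjective K)]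
      exact hx
    obtain ⟨z, hz, hzg⟩ := hYp.exists_mul_mem_normalizer (le_sup_left : Y ≤ Y ⊔ K) (by
      rw [relIndex_sup_right_of_normal]
      exact fun h => hK (h.trans (relIndex_dvd_card _ _))) hg
    obtain ⟨y, hy, k, hk, rfl⟩ := mem_sup_of_normal_right.1 hz
    refine ⟨⟨y⁻¹ * (y * k * g), mul_mem (inv_mem (le_normalizer hy)) hzg⟩, Subtype.ext ?_⟩
    change QuotientGroup.mk' K (y⁻¹ * (y * k * g)) = QuotientGroup.mk' K g
    rw [mul_assoc y, inv_mul_cancel_left, map_mul]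
    have : QuotientGroup.mk' K k = 1 := (QuotientGroup.eq_one_iff _).2 hk
    rw [this, one_mul]

end Thompson

/-- The elements of order dividing `p` in the center of `P`. -/
def Subgroup.omegaCenter (p : ℕ) (P : Type*) [Group P] : Subgroup P where
  carrier := {x | x ∈ center P ∧ x ^ p = 1}
  one_mem' := ⟨one_mem _, one_pow p⟩
  mul_mem' := fun {x y} hx hy => ⟨mul_mem hx.1 hy.1, by
    rw [Commute.mul_pow (mem_center_iff.1 hy.1 x), hx.2, hy.2, one_mul]⟩
  inv_mem' := fun {x} hx => ⟨inv_mem hx.1, by rw [inv_pow, hx.2, inv_one]⟩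

instance Subgroup.omegaCenter_characteristic (p : ℕ) (P : Type*) [Group P] :
    (omegaCenter p P).Characteristic := by
  rw [characteristic_iff_le_comap]
  intro φ x hx
  exact ⟨characteristic_iff_le_comap.1 inferInstance φ hx.1,
    (map_pow φ x p).symm.trans ((congrArg φ hx.2).trans (map_one φ))⟩

theorem IsPGroup.omegaCenter_ne_bot {p : ℕ} [hp : Fact p.Prime] {P : Type*} [Group P] [Finite P]
    [Nontrivial P] (hP : IsPGroup p P) : omegaCenter p P ≠ ⊥ := by
  have := hP.center_nontrivial
  have h1 : p ∣ Nat.card (center P) := by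
    obtain ⟨n, hn, h⟩ := (hP.to_subgroup (center P)).nontrivial_iff_card.1 this
    rw [h]
    exact dvd_pow_self p hn.ne'
  obtain ⟨x, hx⟩ := exists_prime_orderOf_dvd_card' p h1
  intro h
  have h2 : (x : P) ∈ omegaCenter p P := ⟨x.2, by
    have := pow_orderOf_eq_one (x : P)
    rwa [Subgroup.orderOf_coe, hx] at this⟩
  rw [h, mem_bot] at h2
  rw [orderOf_eq_one_iff.2 (Subtype.ext h2)] at hx
  exact hp.out.one_lt.ne hx

/-- The abelian subgroups of maximal order of `P`. -/
def Subgroup.maxAbelian {G : Type*} [Group G] (P : Subgroup G) : Set (Subgroup G) :=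
  {A | A ≤ P ∧ (∀ a ∈ A, ∀ b ∈ A, a * b = b * a) ∧
    ∀ B ≤ P, (∀ a ∈ B, ∀ b ∈ B, a * b = b * a) → Nat.card B ≤ Nat.card A}

/-- The Thompson subgroup of `P`, generated by the abelian subgroups of maximal order. -/
def Subgroup.thompson {G : Type*} [Group G] (P : Subgroup G) : Subgroup G :=
  sSup P.maxAbelian

namespace Subgroup

variable {G H : Type*} [Group G] [Group H]

theorem maxAbelian_nonempty [Finite G] (P : Subgroup G) : P.maxAbelian.Nonempty := by
  obtain ⟨A, hA, hmax⟩ := Set.exists_max_image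
    {A : Subgroup G | A ≤ P ∧ ∀ a ∈ A, ∀ b ∈ A, a * b = b * a} (fun A => Nat.card A)
    (Set.toFinite _) ⟨⊥, bot_le, fun a ha b hb => by rw [mem_bot.1 ha, mem_bot.1 hb]⟩
  exact ⟨A, hA.1, hA.2, fun B hB hB' => hmax B ⟨hB, hB'⟩⟩

theorem thompson_ne_bot [Finite G] {P : Subgroup G} (hP : P ≠ ⊥) : P.thompson ≠ ⊥ := by
  intro h
  obtain ⟨A, hA⟩ := P.maxAbelian_nonempty
  obtain ⟨x, hx, hx1⟩ := P.bot_or_exists_ne_one.resolve_left hP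
  have hA0 : A = ⊥ := le_bot_iff.1 (h ▸ le_sSup hA)
  have h1 := hA.2.2 (zpowers x) ((zpowers_le).2 hx) (by
    rintro _ ⟨m, rfl⟩ _ ⟨n, rfl⟩
    exact zpow_mul_comm x m n)
  rw [hA0, card_bot] at h1
  exact hx1 (zpowers_eq_bot.1 (card_le_one_iff_eq_bot _ |>.1 h1))

theorem map_mem_maxAbelian_iff (f : G →* H) (hf : Function.Injective f) (P A : Subgroup G) :
    A.map f ∈ (P.map f).maxAbelian ↔ A ∈ P.maxAbelian := by
  have hab : ∀ A : Subgroup G, (∀ a ∈ A.map f, ∀ b ∈ A.map f, a * b = b * a) ↔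
      ∀ a ∈ A, ∀ b ∈ A, a * b = b * a := by
    intro A
    constructor
    · intro h a ha b hb
      apply hf
      rw [map_mul, map_mul]
      exact h _ (mem_map_of_mem f ha) _ (mem_map_of_mem f hb)
    · rintro h _ ⟨a, ha, rfl⟩ _ ⟨b, hb, rfl⟩
      rw [← map_mul, h a ha b hb, map_mul]
  refine and_congr (map_le_map_iff_of_injective hf) (and_congr (hab A) ?_)
  constructor
  · intro h B hB hB'
    have := h (B.map f) (map_mono hB) ((hab B).2 hB')
    rwa [card_map_of_injective hf, card_map_of_injective hf] at this
  · intro h B hB hB'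
    obtain ⟨C, rfl⟩ : ∃ C, C.map f = B := ⟨B.comap f, map_comap_eq_self
      (hB.trans (map_le_range f P))⟩
    rw [card_map_of_injective hf, card_map_of_injective hf]
    exact h C ((map_le_map_iff_of_injective hf).1 hB) ((hab C).1 hB')

theorem map_thompson (f : G →* H) (hf : Function.Injective f) (P : Subgroup G) :
    P.thompson.map f = (P.map f).thompson := by
  apply le_antisymm
  · rw [map_le_iff_le_comap]
    exact sSup_le fun A hA => map_le_iff_le_comap.1
      (le_sSup ((map_mem_maxAbelian_iff f hf P A).2 hA))
  · refine sSup_le fun B hB => ?_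
    obtain ⟨C, rfl⟩ : ∃ C, C.map f = B := ⟨B.comap f, map_comap_eq_self
      (hB.1.trans (map_le_range f P))⟩
    exact map_mono (le_sSup ((map_mem_maxAbelian_iff f hf P C).1 hB))

instance thompson_top_characteristic : (⊤ : Subgroup G).thompson.Characteristic := by
  rw [characteristic_iff_map_eq]
  intro φ
  rw [map_thompson _ φ.injective, map_top_of_surjective _ φ.surjective]

theorem map_subtype_thompson_top (P : Subgroup G) :
    (⊤ : Subgroup P).thompson.map P.subtype = P.thompson := by
  rw [map_thompson _ P.subtype_injective, ← MonoidHom.range_eq_map, range_subtype]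

instance thompson_normal (P : Subgroup G) [P.Normal] : P.thompson.Normal := by
  rw [← map_subtype_thompson_top]
  infer_instance

theorem thompson_eq_of_forall_le [Finite G] {P O : Subgroup G} (hO : O ≤ P)
    (h : ∀ A ∈ P.maxAbelian, A ≤ O) : P.thompson = O.thompson := by
  refine congrArg sSup (Set.ext fun A => ⟨fun hA => ⟨h A hA, hA.2.1, fun B hB =>
    hA.2.2 B (hB.trans hO)⟩, fun hA => ⟨hA.1.trans hO, hA.2.1, fun B hB hB' => ?_⟩⟩)
  obtain ⟨A', hA'⟩ := P.maxAbelian_nonempty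
  exact (hA'.2.2 B hB hB').trans (hA.2.2 A' (h A' hA') hA'.2.1)

/-- The replacement inequality for abelian subgroups of maximal order. -/
theorem relIndex_le_of_mem_maxAbelian [Finite G] {P O V A : Subgroup G} [V.Normal]
    (hA : A ∈ P.maxAbelian) (hVO : V ≤ O) (hOP : O ≤ P) (hO : O ≤ centralizer (V : Set G))
    (hV : ∀ v ∈ V, ∀ w ∈ V, v * w = w * v) :
    (centralizer (A : Set G)).relIndex V ≤ O.relIndex A := by
  have h1 : (centralizer (A : Set G)).relIndex V ≤ A.relIndex V :=
    Nat.le_of_dvd (Nat.pos_of_ne_zero index_ne_zero_of_finite)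
      (relIndex_dvd_of_le_left _ fun a ha => mem_centralizer_iff.2 fun b hb => hA.2.1 b hb a ha)
  refine h1.trans ?_
  have h2 : Nat.card ((A ⊓ O) ⊔ V : Subgroup G) ≤ Nat.card A := by
    refine hA.2.2 _ (sup_le (inf_le_left.trans hA.1) (hVO.trans hOP)) ?_
    intro a ha b hb
    obtain ⟨a, ha', v, hv, rfl⟩ := mem_sup_of_normal_right.1 ha
    obtain ⟨b, hb', w, hw, rfl⟩ := mem_sup_of_normal_right.1 hb
    have e1 := hA.2.1 a ha'.1 b hb'.1
    have e2 : w * a = a * w := mem_centralizer_iff.1 (hO ha'.2) w hw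
    have e3 : v * b = b * v := mem_centralizer_iff.1 (hO hb'.2) v hv
    have e4 := hV v hv w hw
    calc a * v * (b * w) = a * (v * b) * w := by simp only [mul_assoc]
      _ = (a * b) * (v * w) := by rw [e3]; simp only [mul_assoc]
      _ = b * (a * w) * v := by rw [e1, e4]; simp only [mul_assoc]
      _ = b * w * (a * v) := by rw [← e2]; simp only [mul_assoc]
  have h3 := (⊥ : Subgroup G).relIndex_mul_relIndex (A ⊓ O) ((A ⊓ O) ⊔ V) bot_le le_sup_left
  have h4 := (⊥ : Subgroup G).relIndex_mul_relIndex (A ⊓ O) A bot_le inf_le_left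
  rw [relIndex_bot_left, relIndex_bot_left, relIndex_sup_right_of_normal] at h3
  rw [relIndex_bot_left, relIndex_bot_left, inf_relIndex_left] at h4
  have h5 : (A ⊓ O).relIndex V = A.relIndex V := by
    rw [← inf_relIndex_right, inf_assoc, inf_eq_right.2 hVO, inf_relIndex_right]
  rw [← h3, ← h4, h5] at h2
  exact Nat.le_of_mul_le_mul_left h2 Nat.card_pos

end Subgroup

section
variable {p : ℕ} [hp : Fact p.Prime] {G : Type*} [Group G] [Finite G]

theorem IsPGroup.le_of_not_dvd_relIndex {S O K : Subgroup G} [O.Normal] (hS : IsPGroup p S)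
    (hSK : S ≤ K) (hOK : O ≤ K) (h : ¬ p ∣ O.relIndex K) : S ≤ O := by
  obtain ⟨n, hn⟩ := IsPGroup.iff_card.1 hS
  have h1 : O.relIndex S ∣ p ^ n := hn ▸ (O.subgroupOf S).index_dvd_card
  have h2 : O.relIndex S ∣ O.relIndex K := by
    rw [← relIndex_sup_right S O]
    rw [← relIndex_mul_relIndex O (S ⊔ O) K le_sup_right (sup_le hSK hOK)]
    exact dvd_mul_right _ _
  obtain ⟨m, -, hm⟩ := (Nat.dvd_prime_pow hp.out).1 h1
  rcases m with _ | m
  · exact relIndex_eq_one.1 (hm.trans (pow_zero p))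
  · exact absurd ((dvd_pow_self p m.succ_ne_zero).trans (hm ▸ h2)) h

theorem IsPGroup.of_inf_of_index {K C : Subgroup G} [K.Normal] {k : ℕ} (hk : K.index = p ^ k)
    (h : IsPGroup p (C ⊓ K : Subgroup G)) : IsPGroup p C := by
  obtain ⟨n, hn⟩ := IsPGroup.iff_card.1 h
  obtain ⟨m, -, hm⟩ := (Nat.dvd_prime_pow hp.out).1 (hk ▸ relIndex_dvd_index_of_normal K C)
  have h1 := (⊥ : Subgroup G).relIndex_mul_relIndex (C ⊓ K) C bot_le inf_le_left
  rw [relIndex_bot_left, relIndex_bot_left, inf_relIndex_left, hn, hm, ← pow_add] at h1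
  exact IsPGroup.of_card h1.symm

theorem IsPNilpotent.of_central {M N : Subgroup G} [N.Normal] (hN : IsPGroup p N)
    (hNM : ¬ p ∣ N.relIndex M) (hc : ∀ x ∈ M, ∀ y ∈ N, x * y = y * x) : IsPNilpotent p M := by
  have hN' : IsPGroup p (N.subgroupOf M) := hN.comap_subtype
  obtain ⟨n, hn⟩ := IsPGroup.iff_card.1 hN'
  have hcop : (Nat.card (N.subgroupOf M)).Coprime (N.subgroupOf M).index := by
    rw [hn]
    exact Nat.Coprime.pow_left _ ((Nat.Prime.coprime_iff_not_dvd hp.out).2 hNM)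
  obtain ⟨H, hH⟩ := exists_right_complement'_of_coprime hcop
  have hsup := hH.sup_eq_top
  have hnorm : H.Normal := by
    rw [← normalizer_eq_top_iff, eq_top_iff, ← hsup]
    refine sup_le (fun x hx => ?_) le_normalizer
    have hxy : ∀ y : M, x * y = y * x := fun y => Subtype.ext (hc y y.2 x hx).symm
    rw [mem_normalizer_iff]
    intro y
    rw [hxy, mul_inv_cancel_right]
  have hidx := hH.symm.index_eq_card
  have hi2 := hH.index_eq_card
  exact ⟨H, hnorm, by rw [← hidx]; exact hNM, n, by rw [hi2, hn]⟩

theorem IsPGroup.centralizer_le {O K : Subgroup G} [O.Normal] [K.Normal] (hO : IsPGroup p O)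
    (hmax : ∀ N : Subgroup G, N.Normal → IsPGroup p N → N ≤ O)
    (hO' : ∀ N : Subgroup G, N.Normal → ¬ p ∣ Nat.card N → N = ⊥) (hOK : O ≤ K)
    (h : ¬ p ∣ O.relIndex K) {k : ℕ} (hk : K.index = p ^ k) : centralizer (O : Set G) ≤ O := by
  have hC : (centralizer (O : Set G)).Normal := inferInstance
  refine hmax _ hC (IsPGroup.of_inf_of_index hk ?_)
  refine IsPNilpotent.isPGroup_of_normal ?_ hO'
  refine IsPNilpotent.of_central (N := O ⊓ centralizer (O : Set G)) ?_ ?_ ?_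
  · exact hO.to_le inf_le_left
  · intro h1
    apply h
    have h2 : (O ⊓ centralizer (O : Set G)).relIndex (centralizer (O : Set G) ⊓ K) =
        O.relIndex (centralizer (O : Set G) ⊓ K) := by
      rw [← inf_relIndex_right, ← inf_relIndex_right O]
      congr 1
      rw [inf_assoc, inf_eq_right.2 (inf_le_left : centralizer (O : Set G) ⊓ K ≤ _)]
    rw [h2, ← relIndex_sup_right _ O] at h1
    rw [← relIndex_mul_relIndex O (centralizer (O : Set G) ⊓ K ⊔ O) K le_sup_right
      (sup_le inf_le_right hOK)]
    exact h1.mul_right _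
  · intro x hx y hy
    exact (mem_centralizer_iff.1 hx.1 y hy.1).symm

end

theorem IsPNilpotent.exists_normal_of_quotient {p : ℕ} {G : Type*} [Group G]
    {O : Subgroup G} [O.Normal] (h : IsPNilpotent p (G ⧸ O)) : ∃ K : Subgroup G, K.Normal ∧ O ≤ K ∧ ¬ p ∣ O.relIndex K ∧
      ∃ k, K.index = p ^ k := by
  obtain ⟨N, hN, hp, k, hk⟩ := h
  refine ⟨N.comap (QuotientGroup.mk' O), inferInstance, ?_, ?_, k, ?_⟩
  · intro x hx
    rw [mem_comap, QuotientGroup.mk'_apply, (QuotientGroup.eq_one_iff x).2 hx]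
    exact one_mem _
  · have := relIndex_comap (⊥ : Subgroup (G ⧸ O)) (QuotientGroup.mk' O)
      (N.comap (QuotientGroup.mk' O))
    rw [MonoidHom.comap_bot, QuotientGroup.ker_mk',
      map_comap_eq_self_of_surjective (QuotientGroup.mk'_surjective O), relIndex_bot_left] at this
    rwa [this]
  · rw [index_comap_of_surjective _ (QuotientGroup.mk'_surjective O), hk]

section
variable {p : ℕ} [hp : Fact p.Prime] {G : Type*} [Group G] [Finite G]

theorem Subgroup.eq_or_eq_of_sylow_le_normalizer {P : Sylow p G} {O K : Subgroup G} [O.Normal]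
    [K.Normal] (hO : IsPGroup p O) (hc : centralizer (O : Set G) ≤ O) (hOK : O ≤ K)
    (h : ¬ p ∣ O.relIndex K)
    (hM : ∀ M : Subgroup G, P ≤ M → M ≠ ⊤ → IsPNilpotent p M) {Y : Subgroup G} (hOY : O ≤ Y)
    (hYK : Y ≤ K) (hPY : P ≤ normalizer (Y : Set G)) : Y = O ∨ Y = K := by
  by_cases hY : Y ⊔ P = ⊤
  · right
    have hn : normalizer (Y : Set G) = ⊤ :=
      top_le_iff.1 (hY ▸ sup_le le_normalizer hPY)
    have hYn : Y.Normal := normalizer_eq_top_iff.1 hn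
    have hPK : (P : Subgroup G) ⊓ K ≤ O :=
      (P.2.to_le inf_le_left).le_of_not_dvd_relIndex inf_le_right hOK h
    refine le_antisymm hYK fun k hk => ?_
    obtain ⟨y, hy, x, hx, rfl⟩ := mem_sup_of_normal_left.1 (hY ▸ mem_top k : k ∈ Y ⊔ P)
    exact mul_mem hy (hOY (hPK ⟨hx, (K.mul_mem_cancel_left (hYK hy)).1 hk⟩))
  · left
    obtain ⟨N, hN, hNp, j, hj⟩ := (hM _ le_sup_right hY).of_le (le_sup_left : Y ≤ Y ⊔ P)
    have hOp : IsPGroup p (O.subgroupOf Y) := hO.comap_subtype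
    have hdis : Disjoint (O.subgroupOf Y) N := hOp.disjoint_of_not_dvd hNp
    have hNO : N ≤ O.subgroupOf Y := by
      intro x hx
      refine hc (mem_centralizer_iff.2 fun y hy => ?_)
      exact congrArg Subtype.val (commute_of_normal_of_disjoint (O.subgroupOf Y) N inferInstance
        hN hdis ⟨y, hOY hy⟩ x hy hx).eq
    have hN0 : N = ⊥ := by
      rw [disjoint_iff, inf_eq_right.2 hNO] at hdis
      exact hdis
    rw [hN0, index_bot] at hj
    exact le_antisymm ((IsPGroup.of_card hj).le_of_not_dvd_relIndex hYK hOK h) hOY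

theorem Subgroup.commutator_le_of_sylow_le_normalizer {P : Sylow p G} {O K : Subgroup G} [O.Normal]
    [K.Normal] (hOK : O ≤ K) (hne : K ≠ O) (h : ¬ p ∣ O.relIndex K)
    (hdich : ∀ Y : Subgroup G, O ≤ Y → Y ≤ K → P ≤ normalizer (Y : Set G) → Y = O ∨ Y = K) :
    ⁅K, K⁆ ≤ O := by
  obtain ⟨Q, _, _, f, hfs, hker⟩ : ∃ (Q : Type _) (_ : Group Q) (_ : Finite Q) (f : G →* Q),
      Function.Surjective f ∧ f.ker = O :=
    ⟨G ⧸ O, inferInstance, inferInstance, QuotientGroup.mk' O, QuotientGroup.mk'_surjective O,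
      QuotientGroup.ker_mk' O⟩
  have hcomap : (⊥ : Subgroup Q).comap f = O := by rw [MonoidHom.comap_bot, hker]
  have hKc : (K.map f).comap f = K := by
    rw [comap_map_eq, hker, sup_eq_left.2 hOK]
  have hKn : (K.map f).Normal := Normal.map inferInstance f hfs
  have hcard : Nat.card (K.map f) = O.relIndex K := by
    rw [← hcomap, relIndex_comap, relIndex_bot_left]
  have hK0 : K.map f ≠ ⊥ := by
    intro h0
    rw [h0, hcomap] at hKc
    exact hne hKc.symm
  obtain ⟨q, hq, hqd⟩ := Nat.exists_prime_and_dvd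
    (fun h1 => hK0 ((card_eq_one).1 h1) : Nat.card (K.map f) ≠ 1)
  have : Fact q.Prime := ⟨hq⟩
  have key : ∀ S : Subgroup Q, S ≤ K.map f →
      ((P : Subgroup G).map f ≤ normalizer (S : Set Q)) → S = ⊥ ∨ S = K.map f := by
    intro S hS hPS
    refine (hdich (S.comap f) ?_ ?_ ?_).imp (fun h1 => ?_) fun h1 => ?_
    · rw [← hcomap]; exact comap_mono bot_le
    · rw [← hKc]; exact comap_mono hS
    · rw [← comap_normalizer_eq_of_surjective _ hfs]
      exact map_le_iff_le_comap.1 hPS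
    · rw [← hcomap] at h1
      exact comap_injective hfs h1
    · rw [← hKc] at h1
      exact comap_injective hfs h1
  obtain ⟨S, hSK, hSq, hSi, hPS⟩ := (P.mapSurjective hfs).exists_le_normalizer_of_not_dvd
    (K := K.map f) (hcard ▸ h) q
  have hPmap : ((P.mapSurjective hfs : Sylow p Q) : Subgroup Q) =
    (P : Subgroup G).map f := rfl
  rcases key S hSK (hPmap ▸ hPS) with h0 | h0
  · rw [h0, relIndex_bot_left] at hSi
    exact absurd hqd hSi
  · have hKq : IsPGroup q (K.map f) := h0 ▸ hSq
    have hnil : Group.IsNilpotent (K.map f) := hKq.isNilpotent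
    have hsol : Group.IsSolvable (K.map f) := inferInstance
    have hnt : Nontrivial (K.map f) := (nontrivial_iff_ne_bot _).2 hK0
    have hlt := Group.IsSolvable.commutator_lt_top_of_nontrivial (K.map f)
    have hcn : ⁅K.map f, K.map f⁆.Normal := inferInstance
    rcases key ⁅K.map f, K.map f⁆ (commutator_le_left _ _)
      (by rw [normalizer_eq_top_iff.2 hcn]; exact le_top) with h1 | h1
    · rw [← map_commutator, map_eq_bot_iff, hker] at h1
      exact h1
    · rw [← map_subtype_commutator] at h1
      exfalso
      apply hlt.ne
      apply map_injective (K.map f).subtype_injective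
      rw [h1, ← MonoidHom.range_eq_map, range_subtype]

end

theorem IsLocallyPNilpotent.of_normal {p : ℕ} [Fact p.Prime] {G : Type*} [Group G]
    {P : Subgroup G} (h : IsLocallyPNilpotent p P.subtype)
    {X : Subgroup P} [hX : X.Characteristic] (hX0 : X ≠ ⊥)
    (hn : normalizer (X.map P.subtype : Set G) = ⊤) : IsPNilpotent p G := by
  have h1 := h X hX hX0
  rw [hn] at h1
  exact h1.of_surjective (topEquiv : (⊤ : Subgroup G) ≃* G).toMonoidHom topEquiv.surjective

theorem IsPGroup.mem_of_commutator_mem {p : ℕ} {G : Type*} [Group G] {P O K : Subgroup G}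
    [O.Normal] [K.Normal]
    (hmax : ∀ N : Subgroup G, N.Normal → IsPGroup p N → N ≤ O) (hP : IsPGroup p P)
    (hOP : O ≤ P) (hKP : K ⊔ P = ⊤) {b : G} (hb : b ∈ P)
    (h : ∀ x ∈ K, b * x * b⁻¹ * x⁻¹ ∈ O) : b ∈ O := by
  obtain ⟨Q, _, f, hfs, hker⟩ : ∃ (Q : Type _) (_ : Group Q) (f : G →* Q),
      Function.Surjective f ∧ f.ker = O :=
    ⟨G ⧸ O, inferInstance, QuotientGroup.mk' O, QuotientGroup.mk'_surjective O,
      QuotientGroup.ker_mk' O⟩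
  have hKn : (K.map f).Normal := Normal.map inferInstance f hfs
  set C : Subgroup G := (centralizer (K.map f : Set Q)).comap f with hC
  have hCn : C.Normal := inferInstance
  have hmem : ∀ c, c ∈ C ↔ ∀ x ∈ K, c * x * c⁻¹ * x⁻¹ ∈ O := by
    intro c
    simp only [hC, mem_comap, mem_centralizer_iff, ← hker, MonoidHom.mem_ker, map_mul, map_inv]
    constructor
    · intro hc x hx
      rw [← hc _ (mem_map_of_mem f hx), mul_inv_cancel_right, mul_inv_cancel]
    · rintro hc _ ⟨x, hx, rfl⟩
      have := hc x hx
      rw [mul_inv_eq_one, mul_inv_eq_iff_eq_mul] at this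
      exact this.symm
  have hK : ∀ k ∈ K, ∀ x ∈ P ⊓ C, k * x * k⁻¹ ∈ P ⊓ C := by
    intro k hk x hx
    refine ⟨?_, hCn.conj_mem x hx.2 k⟩
    have h1 := mul_mem (hOP (inv_mem ((hmem x).1 hx.2 k hk))) hx.1
    rwa [show (x * k * x⁻¹ * k⁻¹)⁻¹ * x = k * x * k⁻¹ by group] at h1
  have hn : (P ⊓ C).Normal := by
    rw [← normalizer_eq_top_iff, ← top_le_iff, ← hKP]
    refine sup_le (fun k hk => mem_normalizer_of_forall_mem (hK k hk) fun x hx => ?_) ?_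
    · have := hK k⁻¹ (inv_mem hk) x hx
      rwa [inv_inv] at this
    · intro g hg
      refine mem_normalizer_of_forall_mem (fun x hx => ⟨P.mul_mem (P.mul_mem hg hx.1) (P.inv_mem hg),
        hCn.conj_mem x hx.2 g⟩) fun x hx => ⟨P.mul_mem (P.mul_mem (P.inv_mem hg) hx.1) hg, ?_⟩
      have := hCn.conj_mem x hx.2 g⁻¹
      rwa [inv_inv] at this
  exact hmax _ hn (hP.to_le inf_le_left) ⟨hb, (hmem b).2 h⟩

theorem IsPNilpotent.of_quotient {p : ℕ} [Fact p.Prime] {G : Type*} [Group G] [Finite G]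
    (hp2 : 2 < p) {P : Sylow p G} {O : Subgroup G} [O.Normal]
    (hO : IsPGroup p O) (hmax : ∀ N : Subgroup G, N.Normal → IsPGroup p N → N ≤ O)
    (hO' : ∀ N : Subgroup G, N.Normal → ¬ p ∣ Nat.card N → N = ⊥)
    (hM : ∀ M : Subgroup G, P ≤ M → M ≠ ⊤ → IsPNilpotent p M)
    (hP : IsLocallyPNilpotent p (P : Subgroup G).subtype) (hq : IsPNilpotent p (G ⧸ O)) :
    IsPNilpotent p G := by
  obtain ⟨K, hKn, hOK, hKp, k, hk⟩ := hq.exists_normal_of_quotient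
  have hOP : O ≤ P := hO.le_sylow_of_normal P
  have hc := hO.centralizer_le hmax hO' hOK hKp hk
  by_contra hG
  have hKO : K ≠ O := by
    rintro rfl
    exact hG (IsPNilpotent.of_normal_of_index hO.isPNilpotent hk)
  have hKP : K ⊔ P = ⊤ := sup_eq_top_of_pComplement hk P
  have hdich : ∀ Y : Subgroup G, O ≤ Y → Y ≤ K → P ≤ normalizer (Y : Set G) → Y = O ∨ Y = K :=
    fun Y hOY hYK hPY => eq_or_eq_of_sylow_le_normalizer hO hc hOK hKp hM hOY hYK hPY
  have hcomm := commutator_le_of_sylow_le_normalizer hOK hKO hKp hdich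
  have hP0 : Nontrivial (P : Subgroup G) := by
    rw [nontrivial_iff_ne_bot]
    intro h0
    have hO0 : O = ⊥ := le_bot_iff.1 (h0 ▸ hOP)
    subst hO0
    apply hKO
    rw [← le_bot_iff]
    exact fun x _ => hc (mem_centralizer_iff.2 fun y hy => by rw [mem_bot.1 hy, mul_one, one_mul])
  set V : Subgroup G := (omegaCenter p O).map O.subtype with hVdef
  have hVn : V.Normal := inferInstance
  have hVO : V ≤ O := map_subtype_le _
  have hVmem : ∀ v, v ∈ V ↔ v ∈ O ∧ (∀ x ∈ O, x * v = v * x) ∧ v ^ p = 1 := by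
    intro v
    constructor
    · rintro ⟨w, hw, rfl⟩
      exact ⟨w.2, fun x hx => congrArg Subtype.val (mem_center_iff.1 hw.1 ⟨x, hx⟩),
        congrArg Subtype.val hw.2⟩
    · rintro ⟨h1, h2, h3⟩
      exact ⟨⟨v, h1⟩, ⟨mem_center_iff.2 fun x => Subtype.ext (h2 x x.2), Subtype.ext h3⟩, rfl⟩
  have hOV : O ≤ centralizer (V : Set G) := fun x hx =>
    mem_centralizer_iff.2 fun v hv => (((hVmem v).1 hv).2.1 x hx).symm
  have hVV : ∀ v ∈ V, ∀ w ∈ V, v * w = w * v := fun v hv w hw =>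
    ((hVmem w).1 hw).2.1 v (hVO hv)
  have hCK : centralizer (V : Set G) ⊓ K = O := by
    have hn : (centralizer (V : Set G) ⊓ K).Normal := inferInstance
    refine (hdich _ (le_inf hOV hOK) inf_le_right
      (by rw [normalizer_eq_top_iff.2 hn]; exact le_top)).resolve_right fun h1 => hG ?_
    refine hP.of_normal (X := omegaCenter p P) P.2.omegaCenter_ne_bot ?_
    have hW : ∀ w ∈ (omegaCenter p P).map (P : Subgroup G).subtype,
        w ∈ V ∧ ∀ x ∈ P, x * w = w * x := by
      rintro _ ⟨w, hw, rfl⟩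
      have h2 : ∀ x ∈ P, x * (w : G) = w * x := fun x hx =>
        congrArg Subtype.val (mem_center_iff.1 hw.1 ⟨x, hx⟩)
      refine ⟨(hVmem _).2 ⟨hc (mem_centralizer_iff.2 fun x hx => h2 x (hOP hx)),
        fun x hx => h2 x (hOP hx), congrArg Subtype.val hw.2⟩, h2⟩
    rw [← top_le_iff, ← hKP]
    refine le_trans (sup_le ?_ ?_) (centralizer_le_normalizer _)
    · intro x hx
      exact mem_centralizer_iff.2 fun w hw => mem_centralizer_iff.1 (inf_eq_right.1 h1 hx) w
        (hW w hw).1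
    · intro x hx
      exact mem_centralizer_iff.2 fun w hw => ((hW w hw).2 x hx).symm
  have hThompson : ¬ ∀ A ∈ (P : Subgroup G).maxAbelian, A ≤ O := by
    intro h1
    refine hG (hP.of_normal (X := (⊤ : Subgroup P).thompson) (thompson_ne_bot ?_) ?_)
    · exact top_ne_bot
    · rw [map_subtype_thompson_top, thompson_eq_of_forall_le hOP h1]
      exact normalizer_eq_top_iff.2 inferInstance
  push Not at hThompson
  obtain ⟨A, hA, hAO⟩ := hThompson
  have hAP := hA.1
  have hle : ∀ b ∈ P, (∀ x ∈ K, b * x * b⁻¹ * x⁻¹ ∈ O) → b ∈ O :=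
    fun b hb => P.2.mem_of_commutator_mem hmax hOP hKP hb
  have hconj : ∀ a x : G, x ∈ K → a * x * a⁻¹ * x⁻¹ ∈ K := fun a x hx =>
    mul_mem (hKn.conj_mem x hx a) (inv_mem hx)
  have hmain := commutator_mem_centralizer_of_relIndex_le hp2 V K A O hVV
    (fun v hv => ((hVmem v).1 hv).2.2) hA.2.1
    (fun x hx y hy => by
      rw [mul_inv_rev, ← mul_assoc, ← commutatorElement_def]
      exact hOV (hcomm (commutator_mem_commutator hx hy)))
    (fun x hx => ⟨O.relIndex K, hKp, hOV ((O.subgroupOf K).pow_index_mem ⟨x, hx⟩)⟩)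
    (fun a ha h1 => hle a (hAP ha) fun x hx => hCK ▸ ⟨h1 x hx, hconj a x hx⟩)
    (relIndex_le_of_mem_maxAbelian hA hVO hOP hOV hVV)
  exact hAO fun a ha => hle a (hAP ha) fun x hx => hCK ▸ ⟨hmain a ha x hx, hconj a x hx⟩

section
variable {p : ℕ} [hp : Fact p.Prime]

theorem IsPGroup.exists_max_normal (p : ℕ) [Fact p.Prime] (G : Type*) [Group G] [Finite G] :
    ∃ O : Subgroup G, O.Normal ∧ IsPGroup p O ∧
      ∀ N : Subgroup G, N.Normal → IsPGroup p N → N ≤ O := by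
  obtain ⟨O, hO, hmax⟩ := Set.exists_max_image {N : Subgroup G | N.Normal ∧ IsPGroup p N}
    (fun N => Nat.card N) (Set.toFinite _) ⟨⊥, inferInstance, IsPGroup.of_bot⟩
  refine ⟨O, hO.1, hO.2, fun N hN hNp => ?_⟩
  have := hO.1
  have h1 := hmax (N ⊔ O) ⟨inferInstance, hNp.to_sup_of_normal_left hO.2⟩
  exact (le_sup_left.trans (eq_of_le_of_card_ge (le_sup_right : O ≤ N ⊔ O) h1).ge)

theorem ThompsonBelow.quotient.{u} {G : Type u} [Group G] [Finite G]
    (ih : ThompsonBelow.{u} p (Nat.card G)) {P : Sylow p G}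
    (hP : IsLocallyPNilpotent p (P : Subgroup G).subtype) {O : Subgroup G} [O.Normal]
    (hO : IsPGroup p O) (hmax : ∀ N : Subgroup G, N.Normal → IsPGroup p N → N ≤ O)
    (hO0 : O ≠ ⊥) : IsPNilpotent p (G ⧸ O) := by
  obtain ⟨Q, _, _, f, hfs, hker, ⟨e⟩⟩ : ∃ (Q : Type u) (_ : Group Q) (_ : Finite Q) (f : G →* Q),
      Function.Surjective f ∧ f.ker = O ∧ Nonempty (Q ≃* G ⧸ O) :=
    ⟨G ⧸ O, inferInstance, inferInstance, QuotientGroup.mk' O, QuotientGroup.mk'_surjective O,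
      QuotientGroup.ker_mk' O, ⟨MulEquiv.refl _⟩⟩
  suffices h : IsPNilpotent p Q from h.of_surjective e.toMonoidHom e.surjective
  have hOP : O ≤ P := hO.le_sylow_of_normal P
  refine ih ?_ ((P : Subgroup G).map f).subtype (subtype_injective _) (P.2.map f) ?_ ?_
  · have h1 := O.index_mul_card
    rw [← hker, index_ker, MonoidHom.range_eq_top.2 hfs, card_top, hker] at h1
    rw [← h1]
    have h2 := one_lt_card_iff_ne_bot O |>.2 hO0
    have h3 : 0 < Nat.card Q := Nat.card_pos
    nlinarith
  · rw [range_subtype]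
    exact (P.mapSurjective hfs).not_dvd_index
  · intro X hX hX0
    set Z := X.map ((P : Subgroup G).map f).subtype with hZ
    have hPZ : (P : Subgroup G) ≤ (normalizer (Z : Set Q)).comap f :=
      map_le_iff_le_comap.1 (le_normalizer.trans (normalizer_le_normalizer_map hX))
    have hne : (normalizer (Z : Set Q)).comap f ≠ ⊤ := by
      intro h1
      rw [comap_normalizer_eq_of_surjective _ hfs, normalizer_eq_top_iff] at h1
      have h2 : Z.comap f ≤ P := by
        refine (comap_mono (map_subtype_le X)).trans ?_
        rw [comap_map_eq, hker, sup_eq_left.2 hOP]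
      have h3 := hmax _ h1 (P.2.to_le h2)
      rw [← hker] at h3
      have h4 : Z = ⊥ := by
        rw [← map_comap_eq_self_of_surjective hfs Z, Subgroup.map_eq_bot_iff]
        exact h3
      exact hX0 ((map_eq_bot_iff_of_injective X (subtype_injective _)).1 h4)
    exact (ih.of_le_of_ne_top hP hPZ hne).of_surjective (f.subgroupComap _)
      (f.subgroupComap_surjective_of_surjective _ hfs)

theorem ThompsonBelow.of_two_lt.{u} (hp2 : 2 < p) (n : ℕ) : ThompsonBelow.{u} p n := by
  induction n with
  | zero => exact fun G P _ _ _ h => absurd h (Nat.not_lt_zero _)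
  | succ n ih =>
    intro G P' _ _ _ hn i hi hP' hidx hloc
    replace ih : ThompsonBelow.{u} p (Nat.card G) := fun H R _ _ _ h =>
      ih (h.trans_le (Nat.le_of_lt_succ hn))
    by_contra hG
    obtain ⟨P, hPi⟩ : ∃ P : Sylow p G, (P : Subgroup G) = i.range :=
      ⟨(hP'.of_equiv (MonoidHom.ofInjective hi)).toSylow hidx, rfl⟩
    have hP : IsLocallyPNilpotent p (P : Subgroup G).subtype := by
      rw [hPi]
      exact hloc.range hi
    have hO' : ∀ N : Subgroup G, N.Normal → ¬ p ∣ Nat.card N → N = ⊥ := fun N hN hNp =>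
      not_not.1 fun h0 => hG (ih.of_normal hP hNp h0)
    obtain ⟨H, hHn, hHp, hH0⟩ := ih.exists_normal hP hG
    obtain ⟨O, hOn, hO, hmax⟩ := IsPGroup.exists_max_normal p G
    have hO0 : O ≠ ⊥ := fun h0 => hH0 (le_bot_iff.1 (h0 ▸ hmax H hHn hHp))
    exact hG (IsPNilpotent.of_quotient hp2 hO hmax hO' (fun M => ih.of_le_of_ne_top hP) hP
      (ih.quotient hP hO hmax hO0))

/-- Thompson's normal `p`-complement theorem, for odd `p`. -/
theorem IsPNilpotent.of_isLocallyPNilpotent {G : Type*} [Group G] [Finite G] (hp2 : 2 < p)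
    (P : Sylow p G) (hP : IsLocallyPNilpotent p (P : Subgroup G).subtype) : IsPNilpotent p G :=
  ThompsonBelow.of_two_lt hp2 _ (Nat.lt_succ_self _) _ (subtype_injective _) P.2
    (by rw [range_subtype]; exact P.not_dvd_index) hP

end

section

theorem IsPNilpotent.of_isNilpotent (p : ℕ) [hp : Fact p.Prime] {G : Type*} [Group G] [Finite G]
    [hG : Group.IsNilpotent G] : IsPNilpotent p G := by
  induction hn : Nat.card G using Nat.strong_induction_on generalizing G with
  | _ n ih =>
  cases subsingleton_or_nontrivial G with
  | inl h => exact (IsPGroup.of_card (n := 0) (by simp)).isPNilpotent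
  | inr h =>
    have hZ : Nontrivial (center G) :=
      (nontrivial_iff_ne_bot _).2 (Group.IsNilpotent.center_ne_bot G)
    obtain ⟨q, hq, hqd⟩ := Nat.exists_prime_and_dvd (Finite.one_lt_card (α := center G)).ne'
    have : Fact q.Prime := ⟨hq⟩
    obtain ⟨x, hx⟩ := exists_prime_orderOf_dvd_card' q hqd
    set N := zpowers (x : G) with hN
    have hNZ : N ≤ center G := zpowers_le.2 x.2
    have hNn : N.Normal := by
      refine ⟨fun y hy g => ?_⟩
      rwa [mem_center_iff.1 (hNZ hy) g, mul_inv_cancel_right]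
    have hNc : Nat.card N = q := by rw [Nat.card_zpowers, Subgroup.orderOf_coe, hx]
    have hq' : IsPNilpotent p (G ⧸ N) := by
      refine ih _ ?_ rfl
      have h1 := N.card_eq_card_quotient_mul_card_subgroup
      rw [hNc, hn] at h1
      rw [h1]
      exact lt_mul_of_one_lt_right Nat.card_pos hq.one_lt
    by_cases hqp : q = p
    · have hNp : IsPGroup p N := IsPGroup.of_card (n := 1) (by rw [hNc, hqp, pow_one])
      obtain ⟨K, hKn, hNK, hK, k, hk⟩ := hq'.exists_normal_of_quotient
      exact IsPNilpotent.of_normal_of_index (IsPNilpotent.of_central hNp hK fun x _ y hy =>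
        mem_center_iff.1 (hNZ hy) x) hk
    · refine hq'.of_hom (QuotientGroup.mk' N) ?_
      rw [QuotientGroup.ker_mk', hNc]
      exact fun h => hqp ((Nat.prime_dvd_prime_iff_eq hp.out hq).1 h).symm

variable {G : Type*} [Group G] [Finite G] {L : Subgroup G}

theorem Subgroup.normalizer_eq_of_isCoatom {G : Type*} [Group G] {L : Subgroup G}
    (hL : IsCoatom L)
    (hcore : ∀ N : Subgroup G, N.Normal → N ≤ L → N = ⊥) {X : Subgroup G} (hXL : X ≤ L)
    (hX : X ≠ ⊥) (hn : L ≤ normalizer (X : Set G)) : normalizer (X : Set G) = L :=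
  (hL.le_iff.1 hn).resolve_left fun h => hX (hcore X (normalizer_eq_top_iff.1 h) hXL)

theorem Subgroup.le_normalizer_map_subtype {G : Type*} [Group G] {L : Subgroup G}
    (X : Subgroup L) [hX : X.Normal] :
    L ≤ normalizer (X.map L.subtype : Set G) := by
  refine le_trans ?_ (le_normalizer_map L.subtype)
  rw [normalizer_eq_top_iff.2 hX, ← MonoidHom.range_eq_map, range_subtype]

theorem Sylow.normal_of_isNilpotent {G : Type*} [Group G] [Finite G] [Group.IsNilpotent G] {p : ℕ}
    [Fact p.Prime] (P : Sylow p G) : (P : Subgroup G).Normal :=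
  Sylow.normal_of_normalizerCondition Group.normalizerCondition_of_isNilpotent P

theorem Sylow.exists_eq_map_of_isCoatom [Group.IsNilpotent L] (hL : IsCoatom L)
    (hcore : ∀ N : Subgroup G, N.Normal → N ≤ L → N = ⊥) {p : ℕ} [Fact p.Prime]
    (h : p ∣ Nat.card L) (P : Sylow p L) :
    ∃ S : Sylow p G, (S : Subgroup G) = (P : Subgroup L).map L.subtype := by
  have hPn := P.normal_of_isNilpotent
  have hP0 : (P : Subgroup L).map L.subtype ≠ ⊥ := fun h0 =>
    P.ne_bot_of_dvd_card h ((map_eq_bot_iff_of_injective _ L.subtype_injective).1 h0)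
  have hnorm := normalizer_eq_of_isCoatom hL hcore (map_subtype_le _) hP0
    (le_normalizer_map_subtype _)
  obtain ⟨S, hS⟩ := (P.2.map L.subtype).exists_le_sylow
  refine ⟨S, le_antisymm ?_ hS⟩
  by_contra hne
  have hnil : Group.IsNilpotent S := S.2.isNilpotent
  have hlt := lt_normalizer_inf_of_isNilpotent (lt_of_le_not_ge hS hne)
  rw [hnorm] at hlt
  have h1 : (P : Subgroup L) ≤ (L ⊓ S).subgroupOf L := map_le_iff_le_comap.1 hlt.le
  have h2 := P.3 (S.2.to_le inf_le_right : IsPGroup p (L ⊓ S : Subgroup G)).comap_subtype h1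
  apply hlt.ne
  rw [← h2]
  exact map_subgroupOf_eq_of_le inf_le_left

theorem IsPNilpotent.of_isCoatom [Group.IsNilpotent L] (hL : IsCoatom L)
    (hcore : ∀ N : Subgroup G, N.Normal → N ≤ L → N = ⊥) {p : ℕ} [Fact p.Prime] (hp2 : 2 < p)
    (h : p ∣ Nat.card L) : IsPNilpotent p G := by
  let P : Sylow p L := default
  have hPn := P.normal_of_isNilpotent
  obtain ⟨S, hS⟩ := P.exists_eq_map_of_isCoatom hL hcore h
  have hloc : IsLocallyPNilpotent p (L.subtype.comp (P : Subgroup L).subtype) := by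
    intro X hX hX0
    rw [← Subgroup.map_map, normalizer_eq_of_isCoatom hL hcore (map_subtype_le _)
      (fun h0 => hX0 ?_) (le_normalizer_map_subtype _)]
    · exact IsPNilpotent.of_isNilpotent p
    · rw [map_eq_bot_iff_of_injective _ L.subtype_injective,
        map_eq_bot_iff_of_injective _ (subtype_injective _)] at h0
      exact h0
  refine IsPNilpotent.of_isLocallyPNilpotent hp2 S ?_
  have h1 := IsLocallyPNilpotent.range (i := L.subtype.comp (P : Subgroup L).subtype)
    (L.subtype_injective.comp (subtype_injective _)) hloc
  rw [MonoidHom.range_comp, range_subtype] at h1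
  rwa [hS]

end

section

/-- The Frattini-type uniqueness step: if `P` acts without fixed points on the normal
`p'`-subgroup `K`, then `N(P)` normalizes every `P`-invariant Sylow `q`-subgroup of `K`. -/
theorem Subgroup.normalizer_le_normalizer_of_inf_eq_bot {p q : ℕ} [Fact p.Prime] [Fact q.Prime]
    {G : Type*} [Group G] [Finite G] {K : Subgroup G} [K.Normal] (P : Sylow p G)
    (hPK : normalizer ((P : Subgroup G) : Set G) ⊓ K = ⊥) {S : Subgroup G} (hSK : S ≤ K)
    (hS : IsPGroup q S) (hSi : ¬ q ∣ S.relIndex K) (hPS : P ≤ normalizer (S : Set G)) :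
    normalizer ((P : Subgroup G) : Set G) ≤ normalizer (S : Set G) := by
  intro l hl
  have hKl : ∀ g : G, g ∈ normalizer (K : Set G) := fun g =>
    normalizer_eq_top_iff.2 ‹K.Normal› ▸ mem_top g
  obtain ⟨k, hk, hkl⟩ := hS.exists_mul_mem_normalizer hSK hSi (hKl l)
  have hlKP : l ∈ normalizer ((K ⊔ P : Subgroup G) : Set G) := by
    have h1 := hKl l
    rw [mem_normalizer_iff_map_conj_eq] at hl h1 ⊢
    rw [Subgroup.map_sup, hl, h1]
  obtain ⟨z, hz, hzl⟩ := P.2.exists_mul_mem_normalizer (Z := normalizer (S : Set G) ⊓ (K ⊔ P))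
    (le_inf hPS le_sup_right)
    (fun h => P.not_dvd_index (h.trans (relIndex_dvd_index_of_le (le_inf hPS le_sup_right))))
    (g := k * l) (inf_normalizer_le_normalizer_inf ⟨le_normalizer hkl,
      mul_mem (le_normalizer (mem_sup_left hk)) hlKP⟩)
  obtain ⟨x, hx, y, hy, rfl⟩ := mem_sup_of_normal_right.1 (sup_comm K _ ▸ hz.2)
  have hyk : y * k ∈ normalizer ((P : Subgroup G) : Set G) := by
    rwa [mul_assoc, Subgroup.mul_mem_cancel_left _ (le_normalizer hx), ← mul_assoc,
      Subgroup.mul_mem_cancel_right _ hl] at hzl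
  have hyk1 : y * k = 1 := by
    rw [← mem_bot, ← hPK]
    exact ⟨hyk, mul_mem hy hk⟩
  have hyS : y ∈ normalizer (S : Set G) := (Subgroup.mul_mem_cancel_left _ (hPS hx)).1 hz.1
  rw [eq_inv_of_mul_eq_one_left hyk1, inv_mem_iff] at hyS
  exact (Subgroup.mul_mem_cancel_left _ hyS).1 hkl

theorem Group.isSolvable_of_normal {G : Type*} [Group G] (K : Subgroup G) [K.Normal]
    (hK : Group.IsSolvable K) (hq : Group.IsSolvable (G ⧸ K)) : Group.IsSolvable G :=
  Group.isSolvable_of_ker_le_range K.subtype (QuotientGroup.mk' K)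
    (by rw [QuotientGroup.ker_mk', range_subtype])

theorem Group.isSolvable_of_coatom_bot {G : Type*} [Group G] (h : IsCoatom (⊥ : Subgroup G)) :
    Group.IsSolvable G := by
  have : Nontrivial G := by
    by_contra hG
    rw [not_nontrivial_iff_subsingleton] at hG
    exact h.1 (Subsingleton.elim _ _)
  obtain ⟨g, hg⟩ := exists_ne (1 : G)
  have h1 : zpowers g = ⊤ := (h.le_iff.1 bot_le).resolve_right (zpowers_ne_bot.2 hg)
  refine Group.isSolvable_of_comm fun a b => ?_
  obtain ⟨m, rfl⟩ := mem_zpowers_iff.1 (h1 ▸ mem_top a)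
  obtain ⟨n, rfl⟩ := mem_zpowers_iff.1 (h1 ▸ mem_top b)
  exact zpow_mul_comm g m n

variable {G : Type*} [Group G] [Finite G] {L : Subgroup G}

theorem Group.isSolvable_of_isCoatom_of_core [Group.IsNilpotent L] (hL : IsCoatom L)
    (hcore : ∀ N : Subgroup G, N.Normal → N ≤ L → N = ⊥) (h2 : 2 ∣ L.index) :
    Group.IsSolvable G := by
  by_cases hL0 : L = ⊥
  · subst hL0
    exact Group.isSolvable_of_coatom_bot hL
  have hodd : ∀ p, p.Prime → p ∣ Nat.card L → 2 < p := by
    intro p hp hpL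
    refine lt_of_le_of_ne hp.two_le ?_
    rintro rfl
    have : Fact (Nat.Prime 2) := ⟨hp⟩
    obtain ⟨S, hS⟩ := (default : Sylow 2 L).exists_eq_map_of_isCoatom hL hcore hpL
    exact S.not_dvd_index (h2.trans (index_dvd_of_le (hS ▸ map_subtype_le _)))
  obtain ⟨K, ⟨hKn, hK0⟩, hmin⟩ := Set.exists_min_image
    {N : Subgroup G | N.Normal ∧ N ≠ ⊥} (fun N => Nat.card N) (Set.toFinite _)
    ⟨⊤, inferInstance, fun h => hL.1 (top_le_iff.1 (h ▸ bot_le))⟩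
  have hKmin : ∀ N : Subgroup G, N.Normal → N ≤ K → N ≠ ⊥ → N = K := fun N hN hNK hN0 =>
    eq_of_le_of_card_ge hNK (hmin N ⟨hN, hN0⟩)
  have hKL : ¬ K ≤ L := fun h => hK0 (hcore K hKn h)
  have hsup : L ⊔ K = ⊤ := hL.2 _ (left_lt_sup.2 hKL)
  have hcop : ∀ p, p.Prime → p ∣ Nat.card L → ¬ p ∣ Nat.card K := by
    intro p hp hpL
    have : Fact p.Prime := ⟨hp⟩
    obtain ⟨N, hN, hNp, k, hk⟩ := IsPNilpotent.of_isCoatom hL hcore (hodd p hp hpL) hpL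
    by_cases h0 : K ⊓ N = ⊥
    · exfalso
      have hKp : IsPGroup p K := by
        refine IsPGroup.of_inf_of_index (K := N) hk ?_
        rw [h0]
        exact IsPGroup.of_bot
      obtain ⟨S, hS⟩ := (default : Sylow p L).exists_eq_map_of_isCoatom hL hcore hpL
      exact hKL ((hKp.le_sylow_of_normal S).trans (hS ▸ map_subtype_le _))
    · have h1 := hKmin _ inferInstance inf_le_left h0
      exact fun h => hNp (h.trans (card_dvd_of_le (inf_eq_left.1 h1)))
  have hKL0 : L ⊓ K = ⊥ :=
    disjoint_iff.1 (disjoint_of_coprime_natCard (Nat.coprime_of_dvd hcop))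
  obtain ⟨p, hp, hpL⟩ := Nat.exists_prime_and_dvd (fun h => hL0 (card_eq_one.1 h))
  have : Fact p.Prime := ⟨hp⟩
  have hPn := (default : Sylow p L).normal_of_isNilpotent
  obtain ⟨P, hP⟩ := (default : Sylow p L).exists_eq_map_of_isCoatom hL hcore hpL
  have hPL : normalizer ((P : Subgroup G) : Set G) = L := by
    rw [hP]
    refine normalizer_eq_of_isCoatom hL hcore (map_subtype_le _) (fun h0 => ?_)
      (le_normalizer_map_subtype _)
    exact (default : Sylow p L).ne_bot_of_dvd_card hpL
      ((map_eq_bot_iff_of_injective _ L.subtype_injective).1 h0)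
  obtain ⟨q, hq, hqK⟩ := Nat.exists_prime_and_dvd (fun h => hK0 (card_eq_one.1 h))
  have : Fact q.Prime := ⟨hq⟩
  obtain ⟨S, hSK, hS, hSi, hPS⟩ := P.exists_le_normalizer_of_not_dvd (hcop p hp hpL) q
  have hLS : L ≤ normalizer (S : Set G) := by
    rw [← hPL]
    exact normalizer_le_normalizer_of_inf_eq_bot P (hPL.symm ▸ hKL0) hSK hS hSi hPS
  have hS0 : S ≠ ⊥ := by
    rintro rfl
    rw [relIndex_bot_left] at hSi
    exact hSi hqK
  have hSn : normalizer (S : Set G) = ⊤ := by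
    refine (hL.le_iff.1 hLS).resolve_right fun h => hS0 ?_
    rw [← le_bot_iff, ← hKL0]
    exact le_inf (le_normalizer.trans h.le) hSK
  have hSK' := hKmin S (normalizer_eq_top_iff.1 hSn) hSK hS0
  have hKnil : Group.IsNilpotent K := (hSK' ▸ hS : IsPGroup q K).isNilpotent
  refine Group.isSolvable_of_normal K inferInstance ?_
  refine Group.isSolvable_of_surjective (f := (QuotientGroup.mk' K).comp L.subtype) ?_
  rw [← MonoidHom.range_eq_top, MonoidHom.range_comp, range_subtype]
  have h1 : (L ⊔ K).map (QuotientGroup.mk' K) = ⊤ := by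
    rw [hsup, map_top_of_surjective _ (QuotientGroup.mk'_surjective K)]
  rw [Subgroup.map_sup, QuotientGroup.map_mk'_self, sup_bot_eq] at h1
  exact h1

end

section

theorem Group.isSolvable_of_isCoatom_of_two_dvd_index {G : Type*} [Group G] [Finite G]
    {L : Subgroup G} [hL' : Group.IsNilpotent L] (hL : IsCoatom L) (h2 : 2 ∣ L.index) :
    Group.IsSolvable G := by
  induction hn : Nat.card G using Nat.strong_induction_on generalizing G with
  | _ n ih =>
  by_cases hcore : ∀ N : Subgroup G, N.Normal → N ≤ L → N = ⊥
  · exact Group.isSolvable_of_isCoatom_of_core hL hcore h2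
  push Not at hcore
  obtain ⟨N, hN, hNL, hN0⟩ := hcore
  have hsurj := QuotientGroup.mk'_surjective N
  have hcomap : (L.map (QuotientGroup.mk' N)).comap (QuotientGroup.mk' N) = L := by
    rw [comap_map_eq, QuotientGroup.ker_mk', sup_eq_left.2 hNL]
  have hLN : Group.IsNilpotent (L.map (QuotientGroup.mk' N)) :=
    Group.nilpotent_of_surjective _ ((QuotientGroup.mk' N).subgroupMap_surjective L)
  have hcoatom : IsCoatom (L.map (QuotientGroup.mk' N)) := by
    refine ⟨fun h => hL.1 ?_, fun M hM => ?_⟩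
    · rw [← hcomap, h, comap_top]
    · have h1 : L < M.comap (QuotientGroup.mk' N) := by
        rw [← hcomap]
        exact (comap_lt_comap_of_surjective hsurj).2 hM
      rw [← map_comap_eq_self_of_surjective hsurj M, hL.2 _ h1, map_top_of_surjective _ hsurj]
  have hNsol : Group.IsSolvable N :=
    Group.isSolvable_of_isSolvable_injective (inclusion_injective hNL)
  refine Group.isSolvable_of_normal N hNsol (ih _ ?_ hcoatom ?_ rfl)
  · have h1 := N.card_eq_card_quotient_mul_card_subgroup
    rw [hn] at h1
    rw [h1]
    exact lt_mul_of_one_lt_right Nat.card_pos ((one_lt_card_iff_ne_bot N).2 hN0)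
  · rwa [← index_comap_of_surjective _ hsurj, hcomap]

end

end NilpotentMaximal

theorem stmt4 {G : Type*} [Group G] [Fintype G] (hG : ¬ IsSolvable G)
    (L : Subgroup G) (hL : IsCoatom L) (hnil : Group.IsNilpotent ↥L)
    (Q : Sylow 2 ↥L) :
    ∃ Q' : Sylow 2 G, (Q' : Subgroup G) = (Q : Subgroup ↥L).map L.subtype := by
  refine ⟨(Q.2.map L.subtype).toSylow ?_, rfl⟩
  rw [Subgroup.index_map_subtype, Nat.prime_two.dvd_mul]
  exact not_or.2 ⟨Q.not_dvd_index,
    fun h => hG (Group.isSolvable_of_isCoatom_of_two_dvd_index hL h)⟩
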